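/- arXiv:2306.08811 — 4 statements merged into one kernel-verified Lean document; each statement's English description precedes it below -/
import Mathlib

section
/- Polar decomposition of a cone over a polytope in a hyperplane: For every polarizing vector ξ for P and every x ∈ W*, Σ_{p ∈ Vert(P)} (−1)^{|E_p^+(ξ)|} 1_{K_p^#(ξ)}(x) = 1_C(x) + (−1)^n · 1_{−C°}(x). -/
open Module

/-- The cone `C = {rη : η ∈ P, r ≥ 0} ⊆ W*` over a polytope `P ⊆ W*`. -/
def coneOver {E : Type*} [AddCommGroup E] [Module ℝ E] (P : Set E) : Set E :=
  {y : E | ∃ r : ℝ, 0 ≤ r ∧ ∃ η ∈ P, y = r • η}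

/-- Combinatorial data of a simple polytope with vertex set `Vert` in the hyperplane `R = 1`: at each
vertex `p`, edge vectors `w p i` with dual coordinate functionals `κ p i` that vanish at `p`. -/
structure IsSimpleVertexData {E : Type*} [AddCommGroup E] [Module ℝ E] {n : ℕ}
    (R : Dual ℝ E) (Vert : Finset E) (w : E → Fin n → E) (κ : E → Fin n → Dual ℝ E) : Prop where
  height : ∀ p ∈ Vert, R p = 1
  height_edge : ∀ p ∈ Vert, ∀ i, R (w p i) = 0
  indep : ∀ p ∈ Vert, LinearIndependent ℝ (w p)
  expand : ∀ p ∈ Vert, ∀ x, x = R x • p + ∑ i, κ p i x • w p i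
  coord_self : ∀ p ∈ Vert, ∀ i, κ p i p = 0
  coord_edge : ∀ p ∈ Vert, ∀ i j, κ p i (w p j) = if i = j then 1 else 0
  coord_nonneg : ∀ p ∈ Vert, ∀ i, ∀ q ∈ Vert, 0 ≤ κ p i q
  edge : ∀ p ∈ Vert, ∀ i, ∃ v ∈ Vert, ∃ c : ℝ, 0 < c ∧ v = p + c • w p i

namespace IsSimpleVertexData

open Finset

variable {E : Type*} [AddCommGroup E] [Module ℝ E] {n : ℕ}

open Classical in
/-- The vertices of the face through `p` spanned by the edges in `S`. -/
noncomputable def face (Vert : Finset E) (κ : E → Fin n → Dual ℝ E) (p : E)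
    (S : Finset (Fin n)) : Finset E :=
  {q ∈ Vert | ∀ i ∉ S, κ p i q = 0}

open Classical in
/-- The edges at `p` along which `ξ` increases. -/
noncomputable def upEdges (w : E → Fin n → E) (ξ : Dual ℝ E) (p : E) : Finset (Fin n) :=
  {i | 0 < ξ (w p i)}

open Classical in
/-- The signed indicator, at `x`, of the tangent cone along the face with vertex set `F`. -/
noncomputable def faceValue (Vert : Finset E) (x : E) (F : Finset E) : ℝ :=
  (-1) ^ finrank ℝ (vectorSpan ℝ (F : Set E)) *
    if ∀ l : Dual ℝ E, (∀ v ∈ Vert, 0 ≤ l v) → (∀ v ∈ F, l v = 0) → 0 ≤ l x then 1 else 0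

open Classical in
/-- The signed indicator, at `x`, of the cone `K_p^#(ξ)`, in coordinates. -/
noncomputable def polarTerm (w : E → Fin n → E) (κ : E → Fin n → Dual ℝ E) (ξ : Dual ℝ E)
    (x p : E) : ℝ :=
  (-1) ^ #(upEdges w ξ p) *
    if ∀ i, (0 < ξ (w p i) → κ p i x < 0) ∧ (ξ (w p i) < 0 → 0 ≤ κ p i x) then 1 else 0

open Classical in
theorem polarTerm_eq_sum_powerset {w : E → Fin n → E} {κ : E → Fin n → Dual ℝ E}
    {ξ : Dual ℝ E} {p : E} (hξ : ∀ i, ξ (w p i) ≠ 0) (x : E) :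
    polarTerm w κ ξ x p = ∑ S ∈ (upEdges w ξ p).powerset,
      (-1 : ℝ) ^ #S * if ∀ i ∉ S, 0 ≤ κ p i x then 1 else 0 := by
  set U := upEdges w ξ p with hU
  let a : Fin n → ℝ := fun i => if 0 ≤ κ p i x then 1 else 0
  have hmem : ∀ i, i ∈ U ↔ 0 < ξ (w p i) := fun i => by simp [hU, upEdges]
  have prod_a : ∀ T : Finset (Fin n), ∏ i ∈ T, a i = if ∀ i ∈ T, 0 ≤ κ p i x then 1 else 0 := by
    intro T
    simp only [a, Finset.prod_ite_zero, Finset.prod_const_one]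
  have hleft : polarTerm w κ ξ x p = (∏ i ∈ U, (-1 + a i)) * ∏ i ∈ Uᶜ, a i := by
    have h1 : ∏ i ∈ U, (-1 + a i) = (-1) ^ #U * if ∀ i ∈ U, κ p i x < 0 then 1 else 0 := by
      have : ∀ i ∈ U, (-1 + a i) = (-1) * if κ p i x < 0 then 1 else 0 := by
        intro i _
        by_cases h : 0 ≤ κ p i x
        · simp [a, h, not_lt.mpr h]
        · simp [a, h, not_le.mp h]
      rw [Finset.prod_congr rfl this, Finset.prod_mul_distrib, Finset.prod_const,
        Finset.prod_ite_zero, Finset.prod_const_one]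
      congr
    rw [h1, prod_a, mul_assoc, ite_zero_mul_ite_zero, mul_one, polarTerm, ← hU]
    have hiff : (∀ i, (0 < ξ (w p i) → κ p i x < 0) ∧ (ξ (w p i) < 0 → 0 ≤ κ p i x)) ↔
        (∀ i ∈ U, κ p i x < 0) ∧ ∀ i ∈ Uᶜ, 0 ≤ κ p i x := by
      simp only [forall_and, mem_compl, hmem, not_lt, le_iff_lt_or_eq (a := ξ _), hξ, or_false]
    rw [if_congr hiff rfl rfl]
  rw [hleft, Finset.prod_add, Finset.sum_mul]
  refine Finset.sum_congr rfl fun S hS => ?_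
  have hSU := mem_powerset.mp hS
  have : (U \ S) ∪ Uᶜ = Sᶜ := by
    ext i
    have := @hSU i
    simp only [mem_union, mem_sdiff, mem_compl]
    tauto
  rw [Finset.prod_const, mul_assoc, ← Finset.prod_union, this, prod_a]
  · simp only [mem_compl]
  · exact disjoint_left.mpr fun i hi h => mem_compl.mp h (mem_sdiff.mp hi).1

variable {R : Dual ℝ E} {Vert : Finset E} {w : E → Fin n → E} {κ : E → Fin n → Dual ℝ E}

theorem mem_face {p q : E} {S : Finset (Fin n)} :
    q ∈ face Vert κ p S ↔ q ∈ Vert ∧ ∀ i ∉ S, κ p i q = 0 := by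
  simp [face]

theorem mem_upEdges {ξ : Dual ℝ E} {p : E} {i : Fin n} :
    i ∈ upEdges w ξ p ↔ 0 < ξ (w p i) := by
  simp [upEdges]

theorem apply_eq (h : IsSimpleVertexData R Vert w κ) {p : E} (hp : p ∈ Vert) (l : Dual ℝ E)
    (x : E) : l x = R x * l p + ∑ i, κ p i x * l (w p i) := by
  conv_lhs => rw [h.expand p hp x]
  simp

theorem apply_vertex (h : IsSimpleVertexData R Vert w κ) {p q : E} (hp : p ∈ Vert)
    (hq : q ∈ Vert) (l : Dual ℝ E) : l q = l p + ∑ i, κ p i q * l (w p i) := by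
  rw [h.apply_eq hp l q, h.height q hq, one_mul]

theorem eq_of_coord_eq_zero (h : IsSimpleVertexData R Vert w κ) {p q : E} (hp : p ∈ Vert)
    (hq : q ∈ Vert) (h0 : ∀ i, κ p i q = 0) : q = p := by
  rw [h.expand p hp q]
  simp [h0, h.height q hq]

theorem self_mem_face (h : IsSimpleVertexData R Vert w κ) {p : E} (hp : p ∈ Vert)
    (S : Finset (Fin n)) : p ∈ face Vert κ p S :=
  mem_face.mpr ⟨hp, fun i _ => h.coord_self p hp i⟩

theorem exists_mem_face (h : IsSimpleVertexData R Vert w κ) {p : E} (hp : p ∈ Vert)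
    {S : Finset (Fin n)} {i : Fin n} (hi : i ∈ S) :
    ∃ v ∈ face Vert κ p S, ∃ c : ℝ, 0 < c ∧ v = p + c • w p i := by
  obtain ⟨v, hv, c, hc, rfl⟩ := h.edge p hp i
  refine ⟨_, mem_face.mpr ⟨hv, fun j hj => ?_⟩, c, hc, rfl⟩
  have : j ≠ i := fun e => hj (e ▸ hi)
  simp [h.coord_self p hp, h.coord_edge p hp, this]

/-- A functional minimised over a face at `p` is nonnegative on the edges of that face at `p`. -/
theorem edge_nonneg (h : IsSimpleVertexData R Vert w κ) {p : E} (hp : p ∈ Vert)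
    {S : Finset (Fin n)} {l : Dual ℝ E} (hl : ∀ v ∈ face Vert κ p S, l p ≤ l v) {i : Fin n}
    (hi : i ∈ S) : 0 ≤ l (w p i) := by
  obtain ⟨v, hv, c, hc, rfl⟩ := h.exists_mem_face hp hi
  have := hl _ hv
  simp only [map_add, map_smul, smul_eq_mul, le_add_iff_nonneg_right] at this
  exact nonneg_of_mul_nonneg_right this hc

theorem edge_nonneg_of_forall_le (h : IsSimpleVertexData R Vert w κ) {p : E} (hp : p ∈ Vert)
    {l : Dual ℝ E} (hl : ∀ v ∈ Vert, l p ≤ l v) (i : Fin n) : 0 ≤ l (w p i) :=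
  h.edge_nonneg hp (S := univ) (fun v hv => hl v (mem_face.mp hv).1) (mem_univ i)

theorem vectorSpan_face (h : IsSimpleVertexData R Vert w κ) {p : E} (hp : p ∈ Vert)
    (S : Finset (Fin n)) :
    vectorSpan ℝ (face Vert κ p S : Set E) = Submodule.span ℝ (w p '' S) := by
  rw [vectorSpan_eq_span_vsub_set_right ℝ (h.self_mem_face hp S)]
  apply le_antisymm <;> rw [Submodule.span_le]
  · rintro _ ⟨v, hv, rfl⟩
    obtain ⟨hvV, hv⟩ := mem_face.mp hv
    have : v -ᵥ p = ∑ i, κ p i v • w p i := by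
      conv_lhs => rw [h.expand p hp v]
      simp [h.height v hvV]
    simp only [this]
    refine Submodule.sum_mem _ fun i _ => ?_
    by_cases hi : i ∈ S
    · exact Submodule.smul_mem _ _ (Submodule.subset_span ⟨i, hi, rfl⟩)
    · simp [hv i hi]
  · rintro _ ⟨i, hi, rfl⟩
    obtain ⟨v, hv, c, hc, hvc⟩ := h.exists_mem_face hp hi
    have : w p i = c⁻¹ • (v -ᵥ p) := by
      rw [hvc, vsub_eq_sub, add_sub_cancel_left, inv_smul_smul₀ hc.ne']
    rw [this]
    exact Submodule.smul_mem _ _ (Submodule.subset_span ⟨v, hv, rfl⟩)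

theorem finrank_vectorSpan_face (h : IsSimpleVertexData R Vert w κ) {p : E} (hp : p ∈ Vert)
    (S : Finset (Fin n)) : finrank ℝ (vectorSpan ℝ (face Vert κ p S : Set E)) = #S := by
  have := finrank_span_eq_card ((h.indep p hp).comp (fun i : S => (i : Fin n))
    Subtype.val_injective)
  rw [h.vectorSpan_face hp, Set.image_eq_range]
  simpa [Function.comp_def] using this

open Classical in
theorem faceValue_face (h : IsSimpleVertexData R Vert w κ) {p : E} (hp : p ∈ Vert)
    (S : Finset (Fin n)) (x : E) :
    faceValue Vert x (face Vert κ p S) =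
      (-1 : ℝ) ^ #S * if ∀ i ∉ S, 0 ≤ κ p i x then 1 else 0 := by
  rw [faceValue, h.finrank_vectorSpan_face hp]
  congr 2
  refine propext ⟨fun H i hi => H (κ p i) (h.coord_nonneg p hp i) fun v hv =>
    (mem_face.mp hv).2 i hi, fun H l hl hl0 => ?_⟩
  have hlp : l p = 0 := hl0 p (h.self_mem_face hp S)
  rw [h.apply_eq hp l x, hlp, mul_zero, zero_add]
  refine Finset.sum_nonneg fun i _ => ?_
  have hnn : 0 ≤ l (w p i) := h.edge_nonneg_of_forall_le hp (by simpa [hlp] using hl) i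
  by_cases hi : i ∈ S
  · have := h.edge_nonneg hp (S := S) (l := -l) (fun v hv => by simp [hlp, hl0 v hv]) hi
    have : l (w p i) = 0 := le_antisymm (by simpa using this) hnn
    simp [this]
  · exact mul_nonneg (H i hi) hnn

/-- `p` is the strict minimum of `ξ` on a face all of whose edges at `p` go up. -/
theorem lt_of_subset_upEdges (h : IsSimpleVertexData R Vert w κ) {p : E} (hp : p ∈ Vert)
    {S : Finset (Fin n)} {ξ : Dual ℝ E} (hS : S ⊆ upEdges w ξ p) {q : E}
    (hq : q ∈ face Vert κ p S) (hqp : q ≠ p) : ξ p < ξ q := by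
  obtain ⟨hqV, hq0⟩ := mem_face.mp hq
  rw [h.apply_vertex hp hqV ξ, lt_add_iff_pos_right]
  have hnn : ∀ i, 0 ≤ κ p i q * ξ (w p i) := by
    intro i
    by_cases hi : i ∈ S
    · exact mul_nonneg (h.coord_nonneg p hp i q hqV) (mem_upEdges.mp (hS hi)).le
    · simp [hq0 i hi]
  refine (Finset.sum_nonneg fun i _ => hnn i).lt_of_ne' fun h0 => hqp ?_
  refine h.eq_of_coord_eq_zero hp hqV fun i => ?_
  have := (Finset.sum_eq_zero_iff_of_nonneg fun i _ => hnn i).mp h0 i (mem_univ i)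
  by_cases hi : i ∈ S
  · exact (mul_eq_zero.mp this).resolve_right (mem_upEdges.mp (hS hi)).ne'
  · exact hq0 i hi

theorem subset_of_face_subset (h : IsSimpleVertexData R Vert w κ) {p : E} (hp : p ∈ Vert)
    {S T : Finset (Fin n)} (hST : face Vert κ p S ⊆ face Vert κ p T) : S ⊆ T := by
  intro i hi
  by_contra hiT
  obtain ⟨v, hv, c, hc, rfl⟩ := h.exists_mem_face hp hi
  have := (mem_face.mp (hST hv)).2 i hiT
  simp [h.coord_self p hp, h.coord_edge p hp, hc.ne'] at this

/-- The same face seen from another of its vertices. -/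
theorem exists_face_eq (h : IsSimpleVertexData R Vert w κ) {p q : E} (hp : p ∈ Vert)
    {S : Finset (Fin n)} (hq : q ∈ face Vert κ p S) :
    ∃ T, face Vert κ q T = face Vert κ p S := by
  classical
  let T : Finset (Fin n) := {i | ∃ v ∈ face Vert κ p S, κ q i v ≠ 0}
  obtain ⟨hqV, hq0⟩ := mem_face.mp hq
  refine ⟨T, Subset.antisymm (fun v hv => ?_) fun v hv => ?_⟩
  · obtain ⟨hvV, hv0⟩ := mem_face.mp hv
    refine mem_face.mpr ⟨hvV, fun j hj => ?_⟩
    have hnn : ∀ i, 0 ≤ κ p j (w q i) := h.edge_nonneg_of_forall_le hqV fun v hv => by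
      rw [hq0 j hj]; exact h.coord_nonneg p hp j v hv
    rw [h.apply_vertex hqV hvV, hq0 j hj, zero_add]
    refine Finset.sum_eq_zero fun i _ => ?_
    by_cases hi : i ∈ T
    · obtain ⟨u, hu, hu0⟩ := (mem_filter.mp hi).2
      obtain ⟨huV, hu1⟩ := mem_face.mp hu
      have := hu1 j hj
      rw [h.apply_vertex hqV huV, hq0 j hj, zero_add, Finset.sum_eq_zero_iff_of_nonneg
        fun i _ => mul_nonneg (h.coord_nonneg q hqV i u huV) (hnn i)] at this
      rw [(mul_eq_zero.mp (this i (mem_univ i))).resolve_left hu0, mul_zero]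
    · rw [hv0 i hi, zero_mul]
  · refine mem_face.mpr ⟨(mem_face.mp hv).1, fun i hi => ?_⟩
    by_contra hne
    exact hi (mem_filter.mpr ⟨mem_univ i, v, hv, hne⟩)

open Classical in
/-- The Brianchon–Gram form of the polar sum, in which `ξ` does not occur. -/
theorem sum_polarTerm_eq_sum_faceValue (h : IsSimpleVertexData R Vert w κ) {ξ : Dual ℝ E}
    (hξ : ∀ p ∈ Vert, ∀ i, ξ (w p i) ≠ 0) (x : E) :
    ∑ p ∈ Vert, polarTerm w κ ξ x p =
      ∑ F ∈ (Vert ×ˢ (univ : Finset (Finset (Fin n)))).image fun a => face Vert κ a.1 a.2,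
        faceValue Vert x F := by
  rw [Finset.sum_congr rfl fun p hp => polarTerm_eq_sum_powerset (hξ p hp) x, Finset.sum_sigma']
  refine Finset.sum_nbij (fun a => face Vert κ a.1 a.2) ?_ ?_ ?_ ?_
  · rintro ⟨p, S⟩ hpS
    simp only [mem_sigma, mem_powerset] at hpS
    exact mem_image.mpr ⟨(p, S), by simp [hpS.1], rfl⟩
  · rintro ⟨p, S⟩ hpS ⟨q, T⟩ hqT heq
    simp only [coe_sigma, Set.mem_sigma_iff, mem_coe, mem_powerset] at hpS hqT
    simp only at heq
    obtain rfl : p = q := by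
      by_contra hne
      exact lt_asymm
        (h.lt_of_subset_upEdges hpS.1 hpS.2 (heq ▸ h.self_mem_face hqT.1 T) (Ne.symm hne))
        (h.lt_of_subset_upEdges hqT.1 hqT.2 (heq ▸ h.self_mem_face hpS.1 S) hne)
    obtain rfl : S = T := Subset.antisymm (h.subset_of_face_subset hpS.1 heq.subset)
      (h.subset_of_face_subset hpS.1 heq.superset)
    rfl
  · intro F hF
    obtain ⟨⟨p, S⟩, hpS, rfl⟩ := mem_image.mp hF
    have hp : p ∈ Vert := (mem_product.mp hpS).1
    obtain ⟨q, hq, hmin⟩ := exists_min_image (face Vert κ p S) ξ ⟨p, h.self_mem_face hp S⟩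
    have hqV := (mem_face.mp hq).1
    obtain ⟨T, hT⟩ := h.exists_face_eq hp hq
    refine ⟨⟨q, T⟩, ?_, hT⟩
    simp only [coe_sigma, Set.mem_sigma_iff, mem_coe, mem_powerset]
    exact ⟨hqV, fun i hi => mem_upEdges.mpr
      ((h.edge_nonneg hqV (hT ▸ hmin) hi).lt_of_ne' (hξ q hqV i))⟩
  · rintro ⟨p, S⟩ hpS
    exact (h.faceValue_face (mem_sigma.mp hpS).1 S x).symm

theorem sum_polarTerm_eq (h : IsSimpleVertexData R Vert w κ) {ξ ξ' : Dual ℝ E}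
    (hξ : ∀ p ∈ Vert, ∀ i, ξ (w p i) ≠ 0) (hξ' : ∀ p ∈ Vert, ∀ i, ξ' (w p i) ≠ 0) (x : E) :
    ∑ p ∈ Vert, polarTerm w κ ξ x p = ∑ p ∈ Vert, polarTerm w κ ξ' x p := by
  rw [h.sum_polarTerm_eq_sum_faceValue hξ, h.sum_polarTerm_eq_sum_faceValue hξ']

/-- There is exactly one vertex all of whose edges go up. -/
theorem existsUnique_forall_pos (h : IsSimpleVertexData R Vert w κ) {ξ : Dual ℝ E}
    (hξ : ∀ p ∈ Vert, ∀ i, ξ (w p i) ≠ 0) (hne : Vert.Nonempty) :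
    ∃ p ∈ Vert, ∀ q ∈ Vert, (∀ i, 0 < ξ (w q i)) ↔ q = p := by
  obtain ⟨p, hp, hmin⟩ := exists_min_image Vert ξ hne
  refine ⟨p, hp, fun q hq => ⟨fun H => ?_, ?_⟩⟩
  · by_contra hqp
    have : p ∈ face Vert κ q univ := mem_face.mpr ⟨hp, fun i hi => (hi (mem_univ i)).elim⟩
    exact (h.lt_of_subset_upEdges hq (fun i _ => mem_upEdges.mpr (H i)) this
      (Ne.symm hqp)).not_ge (hmin q hq)
  · rintro rfl i
    exact (h.edge_nonneg_of_forall_le hq hmin i).lt_of_ne' (hξ q hq i)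

theorem sum_polarTerm_of_nonneg (h : IsSimpleVertexData R Vert w κ) {ξ : Dual ℝ E}
    (hξ : ∀ p ∈ Vert, ∀ i, ξ (w p i) ≠ 0) (hne : Vert.Nonempty) {x : E}
    (hx : ∀ p ∈ Vert, ∀ i, 0 ≤ κ p i x) : ∑ p ∈ Vert, polarTerm w κ ξ x p = 1 := by
  obtain ⟨p, hp, H⟩ := h.existsUnique_forall_pos (ξ := -ξ) (by simpa using hξ) hne
  rw [Finset.sum_eq_single_of_mem p hp]
  · have hneg : ∀ i, ξ (w p i) < 0 := by simpa using (H p hp).mpr rfl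
    have : upEdges w ξ p = ∅ := by
      ext i; simp [mem_upEdges, (hneg i).le]
    rw [polarTerm, this, if_pos fun i => ⟨fun hi => (hi.not_gt (hneg i)).elim,
      fun _ => hx p hp i⟩]
    simp
  · intro q hq hqp
    rw [polarTerm, if_neg, mul_zero]
    refine fun hall => hqp ((H q hq).mp fun i => ?_)
    rcases (hξ q hq i).lt_or_gt with hi | hi
    · simpa using hi
    · exact ((hx q hq i).not_gt ((hall i).1 hi)).elim

theorem sum_polarTerm_of_neg (h : IsSimpleVertexData R Vert w κ) {ξ : Dual ℝ E}
    (hξ : ∀ p ∈ Vert, ∀ i, ξ (w p i) ≠ 0) (hne : Vert.Nonempty) {x : E}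
    (hx : ∀ p ∈ Vert, ∀ i, κ p i x < 0) : ∑ p ∈ Vert, polarTerm w κ ξ x p = (-1) ^ n := by
  obtain ⟨p, hp, H⟩ := h.existsUnique_forall_pos hξ hne
  rw [Finset.sum_eq_single_of_mem p hp]
  · have hpos : ∀ i, 0 < ξ (w p i) := (H p hp).mpr rfl
    have : upEdges w ξ p = univ := by
      ext i; simp [mem_upEdges, hpos i]
    rw [polarTerm, this, if_pos fun i => ⟨fun _ => hx p hp i,
      fun hi => (hi.not_gt (hpos i)).elim⟩]
    simp
  · intro q hq hqp
    rw [polarTerm, if_neg, mul_zero]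
    refine fun hall => hqp ((H q hq).mp fun i => ?_)
    rcases (hξ q hq i).lt_or_gt with hi | hi
    · exact ((hx q hq i).not_ge ((hall i).2 hi)).elim
    · exact hi

open Filter Topology in
/-- The polar sum vanishes at `x` if some functional `ξ₀` separates `x` from the cones; boundary
contact is allowed at vertices where `ξ₀` is nonnegative and nonzero on the edges. -/
theorem sum_polarTerm_of_separated (h : IsSimpleVertexData R Vert w κ) {ξ : Dual ℝ E}
    (hξ : ∀ p ∈ Vert, ∀ i, ξ (w p i) ≠ 0) {x : E} (ξ₀ : Dual ℝ E)
    (hsep : ∀ p ∈ Vert, R x * ξ₀ p < ξ₀ x ∨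
      R x * ξ₀ p = ξ₀ x ∧ (∀ i, 0 ≤ ξ₀ (w p i)) ∧ ∃ i, 0 < ξ₀ (w p i)) :
    ∑ p ∈ Vert, polarTerm w κ ξ x p = 0 := by
  have hpos : ∀ a b : ℝ, 0 < a → ∀ᶠ ε : ℝ in 𝓝[>] 0, 0 < a + ε * b := fun a b ha => by
    have : Tendsto (fun ε : ℝ => a + ε * b) (𝓝 0) (𝓝 a) := by
      have : Continuous fun ε : ℝ => a + ε * b := by fun_prop
      simpa using this.tendsto 0
    exact (this.mono_left nhdsWithin_le_nhds).eventually_const_lt ha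
  have hpolar : ∀ᶠ ε : ℝ in 𝓝[>] 0, ∀ p ∈ Vert, ∀ i, (ξ₀ + ε • ξ) (w p i) ≠ 0 ∧
      (0 < ξ₀ (w p i) → 0 < (ξ₀ + ε • ξ) (w p i)) := by
    simp only [Filter.eventually_all_finset, Filter.eventually_all]
    intro p hp i
    rcases lt_trichotomy (ξ₀ (w p i)) 0 with hlt | heq | hgt
    · filter_upwards [hpos (-ξ₀ (w p i)) (-ξ (w p i)) (by simpa using hlt)] with ε hε
      have : (ξ₀ + ε • ξ) (w p i) < 0 := by
        simp only [LinearMap.add_apply, LinearMap.smul_apply, smul_eq_mul]; linarith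
      exact ⟨this.ne, fun H => (H.not_gt hlt).elim⟩
    · filter_upwards [self_mem_nhdsWithin] with ε hε
      have hε0 : ε ≠ 0 := ne_of_gt hε
      simp [heq, hξ p hp i, hε0]
    · filter_upwards [hpos (ξ₀ (w p i)) (ξ (w p i)) hgt] with ε hε
      exact ⟨hε.ne', fun _ => hε⟩
  have hstrict : ∀ᶠ ε : ℝ in 𝓝[>] 0, ∀ p ∈ Vert, R x * ξ₀ p < ξ₀ x →
      R x * (ξ₀ + ε • ξ) p < (ξ₀ + ε • ξ) x := by
    simp only [Filter.eventually_all_finset]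
    intro p hp
    by_cases hlt : R x * ξ₀ p < ξ₀ x
    · filter_upwards [hpos (ξ₀ x - R x * ξ₀ p) (ξ x - R x * ξ p) (by linarith)] with ε hε _
      simp only [LinearMap.add_apply, LinearMap.smul_apply, smul_eq_mul]; linarith
    · exact Eventually.of_forall fun _ H => (hlt H).elim
  obtain ⟨ε, hε1, hε2⟩ := (hpolar.and hstrict).exists
  rw [h.sum_polarTerm_eq hξ (ξ' := ξ₀ + ε • ξ) (fun p hp i => (hε1 p hp i).1) x]
  refine Finset.sum_eq_zero fun p hp => ?_
  rw [polarTerm, if_neg, mul_zero]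
  intro hall
  rcases hsep p hp with hlt | ⟨heq, hnn, i, hi⟩
  · have h1 := hε2 p hp hlt
    rw [h.apply_eq hp (ξ₀ + ε • ξ) x, lt_add_iff_pos_right] at h1
    refine h1.not_ge (Finset.sum_nonpos fun i _ => ?_)
    rcases ((hε1 p hp i).1).lt_or_gt with hi | hi
    · exact mul_nonpos_of_nonneg_of_nonpos ((hall i).2 hi) hi.le
    · exact mul_nonpos_of_nonpos_of_nonneg ((hall i).1 hi).le hi.le
  · have hle : ∀ j ∈ univ, κ p j x * ξ₀ (w p j) ≤ 0 := fun j _ => by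
      rcases (hnn j).eq_or_lt with h0 | h0
      · simp [← h0]
      · exact mul_nonpos_of_nonpos_of_nonneg ((hall j).1 ((hε1 p hp j).2 h0)).le h0.le
    have h1 : ∑ j, κ p j x * ξ₀ (w p j) < 0 :=
      Finset.sum_neg' hle ⟨i, mem_univ i, mul_neg_of_neg_of_pos ((hall i).1 ((hε1 p hp i).2 hi)) hi⟩
    have := h.apply_eq hp ξ₀ x
    linarith

theorem coord_nonneg_of_mem_coneOver (h : IsSimpleVertexData R Vert w κ) {p : E} (hp : p ∈ Vert)
    (i : Fin n) {x : E} (hx : x ∈ coneOver (convexHull ℝ (Vert : Set E))) : 0 ≤ κ p i x := by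
  obtain ⟨r, hr, η, hη, rfl⟩ := hx
  have hconv : Convex ℝ {y : E | 0 ≤ κ p i y} := convex_halfSpace_ge (κ p i).isLinear 0
  have : 0 ≤ κ p i η := convexHull_min (fun v hv => h.coord_nonneg p hp i v hv) hconv hη
  simpa using mul_nonneg hr this

theorem height_nonneg_of_mem_coneOver (h : IsSimpleVertexData R Vert w κ) {x : E}
    (hx : x ∈ coneOver (convexHull ℝ (Vert : Set E))) : 0 ≤ R x := by
  obtain ⟨r, hr, η, hη, rfl⟩ := hx
  have hconv : Convex ℝ {y : E | 0 ≤ R y} := convex_halfSpace_ge R.isLinear 0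
  have : 0 ≤ R η := convexHull_min (fun v hv => by simp [h.height v hv]) hconv hη
  simpa using mul_nonneg hr this

end IsSimpleVertexData

namespace IsSimpleVertexData

open Finset

variable {E : Type*} [NormedAddCommGroup E] [NormedSpace ℝ E] {n : ℕ}
  {R : Dual ℝ E} {Vert : Finset E} {w : E → Fin n → E} {κ : E → Fin n → Dual ℝ E}

theorem exists_coord_neg (h : IsSimpleVertexData R Vert w κ) (hne : Vert.Nonempty) {x : E}
    (hRx : 0 < R x) (hx : x ∉ coneOver (convexHull ℝ (Vert : Set E))) :
    ∃ p ∈ Vert, ∃ i, κ p i x < 0 := by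
  have hy : (R x)⁻¹ • x ∉ convexHull ℝ (Vert : Set E) := fun hy =>
    hx ⟨R x, hRx.le, _, hy, by rw [smul_inv_smul₀ hRx.ne']⟩
  obtain ⟨f, u, hf, hu⟩ := geometric_hahn_banach_closed_point (convex_convexHull ℝ _)
    (Vert.finite_toSet.isClosed_convexHull ℝ) hy
  obtain ⟨p, hp, hmax⟩ := exists_max_image Vert f hne
  refine ⟨p, hp, ?_⟩
  by_contra! hcon
  let l : Dual ℝ E := f.toLinearMap
  have hle : ∀ i, l (w p i) ≤ 0 := fun i => by
    have := h.edge_nonneg_of_forall_le hp (l := -l) (fun v hv => by simpa [l] using hmax v hv) i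
    simpa using this
  have h1 : l x ≤ R x * l p := by
    rw [h.apply_eq hp l x, add_le_iff_nonpos_right]
    exact Finset.sum_nonpos fun i _ => mul_nonpos_of_nonneg_of_nonpos (hcon i) (hle i)
  have h2 : l p < (R x)⁻¹ * l x := by
    have := (hf p (subset_convexHull ℝ _ hp)).trans hu
    simpa [l] using this
  rw [← div_eq_inv_mul, lt_div_iff₀ hRx] at h2
  linarith

open Topology Filter in
/-- A functional nonnegative on a cone and positive somewhere is positive on its interior. -/
theorem pos_of_mem_interior {s : Set E} {l : Dual ℝ E} (hl : ∀ x ∈ s, 0 ≤ l x) {v : E}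
    (hv : 0 < l v) {x : E} (hx : x ∈ interior s) : 0 < l x := by
  have ht : Tendsto (fun ε : ℝ => x - ε • v) (𝓝[>] 0) (𝓝 x) := by
    have : Continuous fun ε : ℝ => x - ε • v := by fun_prop
    simpa using (this.tendsto 0).mono_left nhdsWithin_le_nhds
  obtain ⟨ε, hε, hεpos⟩ :=
    ((ht.eventually (mem_interior_iff_mem_nhds.mp hx)).and self_mem_nhdsWithin).exists
  have h1 := hl _ hε
  have h2 : 0 < ε * l v := mul_pos hεpos hv
  simp only [map_sub, map_smul, smul_eq_mul] at h1
  linarith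

theorem exists_coord_nonpos [FiniteDimensional ℝ E] (h : IsSimpleVertexData R Vert w κ) (hne : Vert.Nonempty) {x : E}
    (hRx : 0 < R x) (hx : x ∉ interior (coneOver (convexHull ℝ (Vert : Set E)))) :
    ∃ p ∈ Vert, ∃ i, κ p i x ≤ 0 := by
  by_contra! hcon
  refine hx (mem_interior.mpr ⟨{y | 0 < R y} ∩ ⋂ p ∈ Vert, ⋂ i, {y | 0 < κ p i y}, ?_, ?_, ?_⟩)
  · rintro y ⟨hRy, hy⟩
    by_contra hyC
    obtain ⟨p, hp, i, hi⟩ := h.exists_coord_neg hne hRy hyC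
    exact lt_asymm hi (Set.mem_iInter.mp (Set.mem_iInter₂.mp hy p hp) i)
  · refine (isOpen_lt continuous_const R.continuous_of_finiteDimensional).inter ?_
    exact isOpen_biInter_finset fun p _ => isOpen_iInter_of_finite fun i =>
      isOpen_lt continuous_const (κ p i).continuous_of_finiteDimensional
  · simp only [Set.mem_inter_iff, Set.mem_iInter]
    exact ⟨hRx, hcon⟩

theorem sum_polarTerm [FiniteDimensional ℝ E] (h : IsSimpleVertexData R Vert w κ) {ξ : Dual ℝ E}
    (hξ : ∀ p ∈ Vert, ∀ i, ξ (w p i) ≠ 0) (x : E) :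
    ∑ p ∈ Vert, polarTerm w κ ξ x p =
      Set.indicator (coneOver (convexHull ℝ (Vert : Set E))) (fun _ => (1 : ℝ)) x + (-1 : ℝ) ^ n *
        Set.indicator (-(interior (coneOver (convexHull ℝ (Vert : Set E))))) (fun _ => (1 : ℝ))
          x := by
  rcases Vert.eq_empty_or_nonempty with rfl | hne
  · simp [coneOver]
  set C := coneOver (convexHull ℝ (Vert : Set E)) with hC
  obtain ⟨p₀, hp₀⟩ := hne
  have hne : Vert.Nonempty := ⟨p₀, hp₀⟩
  have hzero : (0 : E) ∈ C := ⟨0, le_rfl, p₀, subset_convexHull ℝ _ hp₀, by simp⟩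
  have hR_pos : ∀ y ∈ interior C, 0 < R y := fun y hy =>
    pos_of_mem_interior (fun z hz => h.height_nonneg_of_mem_coneOver hz)
      (v := p₀) (by simp [h.height p₀ hp₀]) hy
  by_cases hx : x ∈ C
  · have hx' : x ∉ -interior C := fun hx' => by
      have h1 := hR_pos (-x) hx'
      have h2 := h.height_nonneg_of_mem_coneOver hx
      rw [map_neg] at h1
      linarith
    rw [h.sum_polarTerm_of_nonneg hξ hne fun p hp i => h.coord_nonneg_of_mem_coneOver hp i hx]
    simp [hx, Set.indicator_of_notMem hx']
  by_cases hx' : x ∈ -interior C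
  · rw [h.sum_polarTerm_of_neg hξ hne, Set.indicator_of_notMem hx, Set.indicator_of_mem hx']
    · ring
    · intro p hp i
      have := pos_of_mem_interior (fun z hz => h.coord_nonneg_of_mem_coneOver hp i hz)
        (v := w p i) (by simp [h.coord_edge p hp]) (Set.mem_neg.mp hx')
      simpa using this
  rw [Set.indicator_of_notMem hx, Set.indicator_of_notMem hx', mul_zero, add_zero]
  rcases lt_trichotomy (R x) 0 with hR | hR | hR
  · obtain ⟨p, hp, i, hi⟩ := h.exists_coord_nonpos hne (x := -x) (by simpa using hR) hx'
    rw [map_neg, Left.neg_nonpos_iff] at hi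
    refine h.sum_polarTerm_of_separated hξ (κ p i) fun q hq => ?_
    have hq0 := h.coord_nonneg p hp i q hq
    have hle : R x * κ p i q ≤ 0 := mul_nonpos_of_nonpos_of_nonneg hR.le hq0
    rcases (hle.trans hi).lt_or_eq with hlt | heq
    · exact Or.inl hlt
    have hκq : κ p i q = 0 :=
      (mul_eq_zero.mp (le_antisymm hle (heq ▸ hi))).resolve_left hR.ne
    have hnn : ∀ j, 0 ≤ κ p i (w q j) := h.edge_nonneg_of_forall_le hq fun v hv => by
      rw [hκq]; exact h.coord_nonneg p hp i v hv
    refine Or.inr ⟨heq, hnn, ?_⟩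
    by_contra! hcon
    have h1 := h.apply_eq hq (κ p i) (w p i)
    rw [h.coord_edge p hp, if_pos rfl, hκq, mul_zero, zero_add, Finset.sum_eq_zero
      fun j _ => by rw [le_antisymm (hcon j) (hnn j), mul_zero]] at h1
    exact one_ne_zero h1
  · have hx0 : x ≠ 0 := fun h0 => hx (h0 ▸ hzero)
    obtain ⟨f, hf⟩ := SeparatingDual.exists_eq_one (R := ℝ) hx0
    exact h.sum_polarTerm_of_separated hξ f.toLinearMap fun p _ => Or.inl (by simp [hR, hf])
  · obtain ⟨p, hp, i, hi⟩ := h.exists_coord_neg hne hR hx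
    refine h.sum_polarTerm_of_separated hξ (-κ p i) fun q hq => Or.inl ?_
    have := mul_nonneg hR.le (h.coord_nonneg p hp i q hq)
    simp only [LinearMap.neg_apply]
    linarith

/-- Coordinates adapted to a point `p` off the hyperplane spanned by `w`. -/
theorem exists_coord {R : Dual ℝ E} (hdim : finrank ℝ E = n + 1) {p : E} (hRp : R p = 1)
    {w : Fin n → E} (hw0 : ∀ i, R (w i) = 0) (hw : LinearIndependent ℝ w) :
    ∃ κ : Fin n → Dual ℝ E, (∀ x, x = R x • p + ∑ i, κ i x • w i) ∧ (∀ i, κ i p = 0) ∧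
      ∀ i j, κ i (w j) = if i = j then 1 else 0 := by
  have hspan : Submodule.span ℝ (Set.range w) ≤ LinearMap.ker R :=
    Submodule.span_le.mpr (by rintro _ ⟨i, rfl⟩; exact hw0 i)
  have hli : LinearIndependent ℝ (Fin.cons p w : Fin (n + 1) → E) :=
    linearIndependent_finCons.mpr ⟨hw, fun hp => by
      have : R p = 0 := hspan hp
      simp [hRp] at this⟩
  let b := basisOfLinearIndependentOfCardEqFinrank hli (by simp [hdim])
  have hb0 : b 0 = p := by simp [b]
  have hbs : ∀ i : Fin n, b i.succ = w i := by simp [b]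
  have hsum : ∀ x, x = b.repr x 0 • p + ∑ i : Fin n, b.repr x i.succ • w i := fun x => by
    conv_lhs => rw [← b.sum_repr x, Fin.sum_univ_succ]
    simp [hb0, hbs]
  have hR : ∀ x, R x = b.repr x 0 := fun x => by
    conv_lhs => rw [hsum x]
    simp [hRp, hw0]
  refine ⟨fun i => b.coord i.succ, fun x => ?_, fun i => ?_, fun i j => ?_⟩
  · rw [hR]; exact hsum x
  · rw [← hb0]; simp
  · rw [← hbs]; simp [Finsupp.single_apply, eq_comm]

theorem exists_of_tangentCone (hdim : finrank ℝ E = n + 1)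
    (hPH : ∀ η ∈ convexHull ℝ (Vert : Set E), R η = 1)
    (hw0 : ∀ p ∈ Vert, ∀ i, R (w p i) = 0)
    (hindep : ∀ p ∈ Vert, LinearIndependent ℝ (w p))
    (htangent : ∀ p ∈ Vert,
      {y : E | ∃ r : ℝ, 0 ≤ r ∧ ∃ x ∈ convexHull ℝ (Vert : Set E), y = p + r • (x - p)} =
        {y : E | ∃ c : Fin n → ℝ, (∀ i, 0 ≤ c i) ∧ y = p + ∑ i, c i • w p i}) :
    ∃ κ : E → Fin n → Dual ℝ E, IsSimpleVertexData R Vert w κ := by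
  classical
  have hVP : ∀ p ∈ Vert, p ∈ convexHull ℝ (Vert : Set E) := fun p hp => subset_convexHull ℝ _ hp
  have hV1 : ∀ p ∈ Vert, R p = 1 := fun p hp => hPH p (hVP p hp)
  have hex : ∀ p, ∃ κ : Fin n → Dual ℝ E, p ∈ Vert →
      (∀ x, x = R x • p + ∑ i, κ i x • w p i) ∧ (∀ i, κ i p = 0) ∧
        ∀ i j, κ i (w p j) = if i = j then 1 else 0 := fun p => by
    by_cases hp : p ∈ Vert
    · obtain ⟨κ, hκ⟩ := exists_coord hdim (hV1 p hp) (hw0 p hp) (hindep p hp)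
      exact ⟨κ, fun _ => hκ⟩
    · exact ⟨0, fun h => (hp h).elim⟩
  choose κ hκ using hex
  have hnn : ∀ p ∈ Vert, ∀ i, ∀ q ∈ Vert, 0 ≤ κ p i q := by
    intro p hp i q hq
    have hmem : q ∈ {y : E | ∃ r : ℝ, 0 ≤ r ∧ ∃ x ∈ convexHull ℝ (Vert : Set E),
        y = p + r • (x - p)} := ⟨1, zero_le_one, q, hVP q hq, by simp⟩
    rw [htangent p hp] at hmem
    obtain ⟨c, hc, hqc⟩ := hmem
    rw [hqc]
    simpa [(hκ p hp).2.1, (hκ p hp).2.2] using hc i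
  refine ⟨κ, hV1, hw0, hindep, fun p hp => (hκ p hp).1, fun p hp => (hκ p hp).2.1,
    fun p hp => (hκ p hp).2.2, hnn, fun p hp i => ?_⟩
  obtain ⟨hexp, hself, hedge⟩ := hκ p hp
  have hmem : p + w p i ∈ {y : E | ∃ c : Fin n → ℝ, (∀ i, 0 ≤ c i) ∧ y = p + ∑ i, c i • w p i} :=
    ⟨Pi.single i 1, fun j => by by_cases hj : j = i <;> simp [hj],
      by simp [Pi.single_apply]⟩
  rw [← htangent p hp] at hmem
  obtain ⟨r, hr, x, hx, hxr⟩ := hmem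
  have hwx : w p i = r • (x - p) := add_left_cancel hxr
  have hcoord : ∀ j, r * κ p j x = if j = i then 1 else 0 := fun j => by
    rw [← hedge j i, hwx]; simp [hself]
  have hr0 : r ≠ 0 := fun h0 => by simpa [h0] using hcoord i
  have hx0 : ∀ j, j ≠ i → κ p j x = 0 := fun j hj =>
    (mul_eq_zero.mp (by rw [hcoord j, if_neg hj])).resolve_left hr0
  obtain ⟨a, ha0, ha1, hax⟩ := Finset.mem_convexHull'.mp hx
  have happ : ∀ j, κ p j x = ∑ v ∈ Vert, a v * κ p j v := fun j => by
    rw [← hax]; simp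
  have hex : ∃ v ∈ Vert, a v * κ p i v ≠ 0 := by
    apply Finset.exists_ne_zero_of_sum_ne_zero
    rw [← happ i]
    intro h0
    simpa [h0] using hcoord i
  obtain ⟨v, hv, hav⟩ := hex
  have hvj : ∀ j, j ≠ i → κ p j v = 0 := fun j hj => by
    have h0 := hx0 j hj
    rw [happ j, Finset.sum_eq_zero_iff_of_nonneg
      fun v hv => mul_nonneg (ha0 v hv) (hnn p hp j v hv)] at h0
    exact (mul_eq_zero.mp (h0 v hv)).resolve_left (left_ne_zero_of_mul hav)
  refine ⟨v, hv, κ p i v, (hnn p hp i v hv).lt_of_ne' (right_ne_zero_of_mul hav), ?_⟩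
  conv_lhs => rw [hexp v]
  rw [hV1 v hv, one_smul, Finset.sum_eq_single_of_mem i (mem_univ i)
    fun j _ hj => by rw [hvj j hj, zero_smul]]

theorem polarTerm_eq_indicator (h : IsSimpleVertexData R Vert w κ) {p : E} (hp : p ∈ Vert)
    (ξ : Dual ℝ E) (x : E) :
    (-1 : ℝ) ^ Nat.card {i : Fin n // 0 < ξ (w p i)} *
        Set.indicator
          {y : E | ∃ c : Fin n → ℝ,
            (∀ i, 0 < ξ (w p i) → c i < 0) ∧
            (∀ i, ξ (w p i) < 0 → 0 ≤ c i) ∧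
            ∃ s : ℝ, y = p + (∑ i, c i • w p i) + s • p}
          (fun _ => (1 : ℝ)) x = polarTerm w κ ξ x p := by
  classical
  rw [polarTerm, Nat.card_eq_fintype_card, Fintype.card_subtype, upEdges, Set.indicator_apply]
  congr! 2
  refine ⟨?_, fun H => ⟨fun i => κ p i x, fun i => (H i).1, fun i => (H i).2, R x - 1, ?_⟩⟩
  · rintro ⟨c, h1, h2, s, rfl⟩ i
    have : κ p i (p + (∑ i, c i • w p i) + s • p) = c i := by
      simp [h.coord_self p hp, h.coord_edge p hp]
    rw [this]
    exact ⟨h1 i, h2 i⟩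
  · conv_lhs => rw [h.expand p hp x]
    rw [sub_smul, one_smul]
    abel

end IsSimpleVertexData

/-- **Polar decomposition of a cone over a polytope in a hyperplane.**
`E` plays the role of the dual space `W*` of an `(n+1)`-dimensional real
vector space `W`; vectors `R, ξ ∈ W` are represented by the corresponding
functionals on `E` (via `W ≅ W**`), so that `⟨η, R⟩` becomes `R η`.
`P` is a simple convex polytope in the affine hyperplane `H = {η : R η = 1}`,
whose edge vectors at each vertex form a basis of the direction space
`ker R`, `C` is the cone over `P`, and `K_p^#(ξ) = C_p^#(ξ) + ℝ p`.  For every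
polarizing vector `ξ` and every `x ∈ W*`:
`Σ_{p ∈ Vert} (−1)^{|E_p^+(ξ)|} 1_{K_p^#(ξ)}(x) = 1_C(x) + (−1)^n · 1_{−C°}(x)`. -/
theorem polar_decomposition_cone_over_polytope_in_hyperplane
    {E : Type*} [NormedAddCommGroup E] [NormedSpace ℝ E] [FiniteDimensional ℝ E]
    {n : ℕ} (hdim : finrank ℝ E = n + 1)
    (R : Module.Dual ℝ E)
    (P : Set E) (hPH : ∀ η ∈ P, R η = 1)
    (Vert : Finset E) (w : E → Fin n → E)
    (hPcompact : IsCompact P)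
    (hPhull : P = convexHull ℝ (Vert : Set E))
    (hw0 : ∀ p ∈ Vert, ∀ i, R (w p i) = 0)
    (hindep : ∀ p ∈ Vert, LinearIndependent ℝ (w p))
    (hspan : ∀ p ∈ Vert, Submodule.span ℝ (Set.range (w p)) = LinearMap.ker R)
    (htangent : ∀ p ∈ Vert,
      {y : E | ∃ r : ℝ, 0 ≤ r ∧ ∃ x ∈ P, y = p + r • (x - p)} =
        {y : E | ∃ c : Fin n → ℝ, (∀ i, 0 ≤ c i) ∧ y = p + ∑ i, c i • w p i})
    (ξ : Module.Dual ℝ E)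
    (hpol : ∀ p ∈ Vert, ∀ i, ξ (w p i) ≠ 0)
    (x : E) :
    ∑ p ∈ Vert,
        (-1 : ℝ) ^ Nat.card {i : Fin n // 0 < ξ (w p i)} *
          Set.indicator
            {y : E | ∃ c : Fin n → ℝ,
              (∀ i, 0 < ξ (w p i) → c i < 0) ∧
              (∀ i, ξ (w p i) < 0 → 0 ≤ c i) ∧
              ∃ s : ℝ, y = p + (∑ i, c i • w p i) + s • p}
            (fun _ => (1 : ℝ)) x =
      Set.indicator (coneOver P) (fun _ => (1 : ℝ)) x +
        (-1 : ℝ) ^ n *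
          Set.indicator (-(interior (coneOver P))) (fun _ => (1 : ℝ)) x := by
  subst hPhull
  obtain ⟨κ, h⟩ := IsSimpleVertexData.exists_of_tangentCone hdim hPH hw0 hindep htangent
  rw [← h.sum_polarTerm hpol x]
  exact Finset.sum_congr rfl fun p hp => h.polarTerm_eq_indicator hp ξ x
end

section
/- Dual polar decomposition of a cone over a polytope in a hyperplane: For every polarizing vector ξ for P and every x ∈ W*, Σ_{p ∈ Vert(P)} (−1)^{|E_p^+(ξ)|} 1_{Ǩ_p^#(ξ)}(x) = (−1)^n · 1_{C°}(x) + 1_{−C}(x). -/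
open Module

section SimplePolytope

open Finset

/-- The contribution of one edge direction to the polarized indicator: `b` says whether the edge
counts as positive and `c` is the coordinate along it. -/
noncomputable def polarFactor (b : Prop) (c : ℝ) : ℝ :=
  open Classical in if b then (if 0 < c then -1 else 0) else (if 0 < c then 0 else 1)

theorem polarFactor_sub (c : ℝ) : polarFactor True c - polarFactor False c = -1 := by
  unfold polarFactor; split_ifs <;> simp_all

theorem polarFactor_ne_zero_iff {b : Prop} {c : ℝ} : polarFactor b c ≠ 0 ↔ (b ↔ 0 < c) := by
  unfold polarFactor; split_ifs <;> simp_all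

/-- A functional can be perturbed to be nonzero on finitely many given nonzero vectors, without
changing its nonzero signs. -/
theorem exists_dual_refining_signs {E ι : Type*} [AddCommGroup E] [Module ℝ E] [Finite ι]
    (η : Dual ℝ E) (v : ι → E) (hv : ∀ i, v i ≠ 0) :
    ∃ ξ : Dual ℝ E, ∀ i, ξ (v i) ≠ 0 ∧ (0 < η (v i) → 0 < ξ (v i)) ∧
      (η (v i) < 0 → ξ (v i) < 0) := by
  obtain ⟨ζ, hζ⟩ := Module.exists_dual_forall_apply_ne_zero (K := ℝ) v hv
  have hev : ∀ᶠ ε in nhdsWithin (0 : ℝ) (Set.Ioi 0), ∀ i, (η + ε • ζ) (v i) ≠ 0 ∧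
      (0 < η (v i) → 0 < (η + ε • ζ) (v i)) ∧ (η (v i) < 0 → (η + ε • ζ) (v i) < 0) := by
    rw [Filter.eventually_all]
    intro i
    have hcont : Filter.Tendsto (fun ε : ℝ => (η + ε • ζ) (v i)) (nhdsWithin 0 (Set.Ioi 0))
        (nhds (η (v i))) := by
      have : Continuous fun ε : ℝ => (η + ε • ζ) (v i) := by
        simp only [LinearMap.add_apply, LinearMap.smul_apply, smul_eq_mul]
        fun_prop
      have h0 := this.tendsto 0
      rw [zero_smul, add_zero] at h0
      exact h0.mono_left nhdsWithin_le_nhds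
    rcases lt_trichotomy (η (v i)) 0 with hlt | h0 | hgt
    · filter_upwards [hcont.eventually_lt_const hlt] with ε hε
      exact ⟨hε.ne, fun hc => absurd hc hlt.not_gt, fun _ => hε⟩
    · filter_upwards [self_mem_nhdsWithin] with ε hε
      have : ε ≠ 0 := (Set.mem_Ioi.1 hε).ne'
      simp [h0, this, hζ i]
    · filter_upwards [hcont.eventually_const_lt hgt] with ε hε
      exact ⟨hε.ne', fun _ => hε, fun hc => absurd hc hgt.not_gt⟩
  obtain ⟨ε, hε⟩ := hev.exists
  exact ⟨η + ε • ζ, hε⟩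

/-- The vertices `V` of a simple polytope at height `R = 1`, with edge vectors `w p` at each vertex
`p` and the coordinates `α p` they define, extended to the whole space by vanishing at `p`. -/
structure IsSimplePolytopeData {E : Type*} [AddCommGroup E] [Module ℝ E] {n : ℕ}
    (R : Dual ℝ E) (V : Finset E) (w : E → Fin n → E) (α : E → Fin n → Dual ℝ E) : Prop where
  height_vertex : ∀ p ∈ V, R p = 1
  height_edge : ∀ p ∈ V, ∀ k, R (w p k) = 0
  expand : ∀ p ∈ V, ∀ x, x = R x • p + ∑ k, α p k x • w p k
  coord_edge : ∀ p ∈ V, ∀ k l, α p k (w p l) = if k = l then 1 else 0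
  coord_self : ∀ p ∈ V, ∀ k, α p k p = 0
  coord_nonneg : ∀ p ∈ V, ∀ q ∈ V, ∀ k, 0 ≤ α p k q
  edge_mem_cone : ∀ p ∈ V, ∀ k, ∃ c : E → ℝ, (∀ v ∈ V, 0 ≤ c v) ∧ w p k = ∑ v ∈ V, c v • (v - p)

/-- The signed sum over the vertices of the polarized cones, where `s` decides which edge vectors
count as positive. -/
noncomputable def polarSum {E : Type*} [AddCommGroup E] [Module ℝ E] {n : ℕ}
    (V : Finset E) (w : E → Fin n → E) (α : E → Fin n → Dual ℝ E) (s : E → Prop) (x : E) : ℝ :=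
  ∑ p ∈ V, ∏ k, polarFactor (s (w p k)) (α p k x)

theorem polarSum_congr {E : Type*} [AddCommGroup E] [Module ℝ E] {n : ℕ} {V : Finset E}
    {w : E → Fin n → E} {α : E → Fin n → Dual ℝ E} {s s' : E → Prop} {x : E}
    (hs : ∀ p ∈ V, ∀ k, s (w p k) ↔ s' (w p k)) :
    polarSum V w α s x = polarSum V w α s' x :=
  Finset.sum_congr rfl fun p hp => Finset.prod_congr rfl fun k _ => by rw [hs p hp k]

/-- Positivity for the infinitesimal perturbation of `ξ` in the direction `δ`. -/
def LexPos {E : Type*} [AddCommGroup E] [Module ℝ E] (ξ δ : Dual ℝ E) (u : E) : Prop :=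
  0 < ξ u ∨ (ξ u = 0 ∧ 0 < δ u)

namespace IsSimplePolytopeData

variable {E : Type*} [AddCommGroup E] [Module ℝ E] {n : ℕ} {R : Dual ℝ E} {V : Finset E}
  {w : E → Fin n → E} {α : E → Fin n → Dual ℝ E}

theorem edge_ne_zero (h : IsSimplePolytopeData R V w α) {p : E} (hp : p ∈ V) (k : Fin n) :
    w p k ≠ 0 := by
  intro h0
  have := h.coord_edge p hp k k
  simp [h0] at this

theorem expand_of_height_eq_zero (h : IsSimplePolytopeData R V w α) {p : E} (hp : p ∈ V) {u : E}
    (hu : R u = 0) : u = ∑ k, α p k u • w p k := by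
  have := h.expand p hp u
  rwa [hu, zero_smul, zero_add] at this

theorem expand_vertex (h : IsSimplePolytopeData R V w α) {p q : E} (hp : p ∈ V) (hq : q ∈ V) :
    q = p + ∑ k, α p k q • w p k := by
  have := h.expand p hp q
  rwa [h.height_vertex q hq, one_smul] at this

theorem apply_eq (h : IsSimplePolytopeData R V w α) {p : E} (hp : p ∈ V) (f : Dual ℝ E) (x : E) :
    f x = R x * f p + ∑ k, α p k x * f (w p k) := by
  conv_lhs => rw [h.expand p hp x]
  simp

theorem eq_of_coord_eq_zero (h : IsSimplePolytopeData R V w α) {p q : E} (hp : p ∈ V)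
    (hq : q ∈ V) (h0 : ∀ k, α p k q = 0) : q = p := by
  have := h.expand_vertex hp hq
  simpa [h0] using this

/-- A functional that is minimal over the vertices at `p` is nonnegative on the edges at `p`. -/
theorem edge_nonneg_of_isMin (h : IsSimplePolytopeData R V w α) {p : E} (hp : p ∈ V)
    {f : Dual ℝ E} (hf : ∀ v ∈ V, f p ≤ f v) (k : Fin n) : 0 ≤ f (w p k) := by
  obtain ⟨c, hc, hw⟩ := h.edge_mem_cone p hp k
  rw [hw, map_sum]
  refine Finset.sum_nonneg fun v hv => ?_
  rw [map_smul, map_sub, smul_eq_mul]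
  exact mul_nonneg (hc v hv) (sub_nonneg.2 (hf v hv))

theorem existsUnique_isMax (h : IsSimplePolytopeData R V w α) (hV : V.Nonempty) {ξ : Dual ℝ E}
    (hξ : ∀ p ∈ V, ∀ k, ξ (w p k) ≠ 0) :
    ∃ p ∈ V, (∀ k, ξ (w p k) < 0) ∧ ∀ q ∈ V, (∀ k, ξ (w q k) < 0) → q = p := by
  obtain ⟨p, hp, hmax⟩ := V.exists_max_image ξ hV
  refine ⟨p, hp, fun k => ?_, fun q hq hneg => ?_⟩
  · have := h.edge_nonneg_of_isMin hp (f := -ξ) (fun v hv => by simpa using hmax v hv) k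
    exact lt_of_le_of_ne (by simpa using this) (hξ p hp k)
  · have h1 := h.apply_eq hq ξ p
    rw [h.height_vertex p hp, one_mul] at h1
    have h2 : ∀ k ∈ univ, α q k p * ξ (w q k) ≤ 0 := fun k _ =>
      mul_nonpos_of_nonneg_of_nonpos (h.coord_nonneg q hq p hp k) (hneg k).le
    have h3 : ∑ k, α q k p * ξ (w q k) = 0 :=
      le_antisymm (Finset.sum_nonpos h2) (by linarith [hmax q hq])
    rw [Finset.sum_eq_zero_iff_of_nonpos h2] at h3
    refine (h.eq_of_coord_eq_zero hq hp fun k => ?_).symm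
    exact (mul_eq_zero.1 (h3 k (mem_univ k))).resolve_right (hneg k).ne

/-- A `p`-coordinate that vanishes at the vertex `q` is nonnegative on the edge vectors at `q`. -/
theorem coord_edge_nonneg (h : IsSimplePolytopeData R V w α) {p q : E} (hp : p ∈ V) (hq : q ∈ V)
    {k : Fin n} (hk : α p k q = 0) (l : Fin n) : 0 ≤ α p k (w q l) :=
  h.edge_nonneg_of_isMin hq (fun v hv => by rw [hk]; exact h.coord_nonneg p hp v hv k) l

/-- The edge of the polytope at `p` in direction `w p i` ends in another vertex. -/
theorem exists_endpoint (h : IsSimplePolytopeData R V w α) {p : E} (hp : p ∈ V) (i : Fin n) :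
    ∃ q ∈ V, 0 < α p i q ∧ ∀ k, k ≠ i → α p k q = 0 := by
  obtain ⟨c, hc, hw⟩ := h.edge_mem_cone p hp i
  have key : ∀ k, α p k (w p i) = ∑ v ∈ V, c v * α p k v := fun k => by
    rw [hw]; simp [h.coord_self p hp]
  have hpos : ∀ k, ∀ v ∈ V, 0 ≤ c v * α p k v := fun k v hv =>
    mul_nonneg (hc v hv) (h.coord_nonneg p hp v hv k)
  obtain ⟨q, hq, hqi⟩ : ∃ q ∈ V, 0 < c q * α p i q := by
    refine (Finset.sum_pos_iff_of_nonneg (hpos i)).1 ?_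
    rw [← key, h.coord_edge p hp]; simp
  refine ⟨q, hq, pos_of_mul_pos_right hqi (hc q hq), fun k hk => ?_⟩
  have h0 := key k
  rw [h.coord_edge p hp, if_neg hk, eq_comm, Finset.sum_eq_zero_iff_of_nonneg (hpos k)] at h0
  exact (mul_eq_zero.1 (h0 q hq)).resolve_left (left_ne_zero_of_mul hqi.ne')

theorem eq_add_smul_edge (h : IsSimplePolytopeData R V w α) {p q : E} (hp : p ∈ V) (hq : q ∈ V)
    {i : Fin n} (h0 : ∀ k, k ≠ i → α p k q = 0) : q = p + α p i q • w p i := by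
  conv_lhs => rw [h.expand_vertex hp hq]
  congr 1
  exact Fintype.sum_eq_single i fun k hk => by rw [h0 k hk, zero_smul]

/-- The edge at `p` with endpoint `q` is also an edge at `q`. -/
theorem exists_opposite_edge (h : IsSimplePolytopeData R V w α) {p q : E} (hp : p ∈ V)
    (hq : q ∈ V) {i : Fin n} (hi : 0 < α p i q) (h0 : ∀ k, k ≠ i → α p k q = 0) :
    ∃ j, 0 < α q j p ∧ (∀ l, l ≠ j → α q l p = 0) ∧
      (∀ k, k ≠ i → α p k (w q j) = 0) ∧ ∃ a : ℝ, 0 < a ∧ w q j = -a • w p i := by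
  have hne : ∃ j, α q j p ≠ 0 := by
    by_contra! hall
    have : p = q := h.eq_of_coord_eq_zero hq hp hall
    rw [← this, h.coord_self p hp] at hi
    exact hi.false
  have hzero : ∀ j, α q j p ≠ 0 → ∀ k, k ≠ i → α p k (w q j) = 0 := by
    intro j hj k hk
    have h1 := h.apply_eq hq (α p k) p
    rw [h.coord_self p hp, h0 k hk, mul_zero, zero_add, eq_comm,
      Finset.sum_eq_zero_iff_of_nonneg (fun l _ => mul_nonneg (h.coord_nonneg q hq p hp l)
        (h.coord_edge_nonneg hp hq (h0 k hk) l))] at h1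
    exact (mul_eq_zero.1 (h1 j (mem_univ j))).resolve_left hj
  have hmul : ∀ j, α q j p ≠ 0 → w q j = α p i (w q j) • w p i := by
    intro j hj
    conv_lhs => rw [h.expand_of_height_eq_zero hp (h.height_edge q hq j)]
    exact Fintype.sum_eq_single i fun k hk => by rw [hzero j hj k hk, zero_smul]
  obtain ⟨j, hj⟩ := hne
  have hjpos : 0 < α q j p := lt_of_le_of_ne (h.coord_nonneg q hq p hp j) hj.symm
  have h1 : α q j p + α p i q * α q j (w p i) = 0 := by
    have := congrArg (α q j) (h.eq_add_smul_edge hp hq h0)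
    rw [h.coord_self q hq, map_add, map_smul, smul_eq_mul] at this
    exact this.symm
  have h2 : α p i (w q j) * α q j (w p i) = 1 := by
    have := congrArg (α q j) (hmul j hj)
    rw [h.coord_edge q hq, if_pos rfl, map_smul, smul_eq_mul] at this
    exact this.symm
  refine ⟨j, hjpos, fun l hl => ?_, hzero j hj, -α p i (w q j), ?_, ?_⟩
  · by_contra hl0
    have h3 := congrArg (α q l) (hmul j hj)
    rw [h.coord_edge q hq, if_neg hl, map_smul, smul_eq_mul] at h3
    have h4 := congrArg (α q l) (hmul l hl0)
    rw [h.coord_edge q hq, if_pos rfl, map_smul, smul_eq_mul] at h4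
    rcases mul_eq_zero.1 h3.symm with h5 | h5
    · rw [h5, zero_mul] at h2; exact zero_ne_one h2
    · rw [h5, mul_zero] at h4; exact one_ne_zero h4
  · have : α q j (w p i) < 0 := by
      by_contra! hc
      nlinarith [mul_nonneg hi.le hc]
    nlinarith
  · rw [neg_neg]; exact hmul j hj

/-- The edge vectors at the two ends of an edge agree modulo the edge direction, up to order and
positive scalars. -/
theorem exists_perm (h : IsSimplePolytopeData R V w α) {p q : E} (hp : p ∈ V)
    (hq : q ∈ V) {i : Fin n} (hi : 0 < α p i q) (h0 : ∀ k, k ≠ i → α p k q = 0) :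
    ∃ σ : Equiv.Perm (Fin n), (0 < α q (σ i) p ∧ ∀ l, l ≠ σ i → α q l p = 0) ∧
      (∃ a : ℝ, 0 < a ∧ w q (σ i) = -a • w p i) ∧
      ∀ k, k ≠ i → ∃ a : ℝ, 0 < a ∧ (∃ b : ℝ, w q (σ k) = a • w p k + b • w p i) ∧
        ∀ x, α p k x = a * α q (σ k) x := by
  obtain ⟨j, hj, hj0, hpj, hopp⟩ := h.exists_opposite_edge hp hq hi h0
  have hprod : ∀ k k', k' ≠ i → ∀ l, 0 ≤ α q l (w p k) * α p k' (w q l) := by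
    intro k k' hk' l
    by_cases hl : l = j
    · rw [hl, hpj k' hk', mul_zero]
    · exact mul_nonneg (h.coord_edge_nonneg hq hp (hj0 l hl) k)
        (h.coord_edge_nonneg hp hq (h0 k' hk') l)
  have hsum : ∀ k k', ∑ l, α q l (w p k) * α p k' (w q l) = if k' = k then 1 else 0 := by
    intro k k'
    rw [← h.coord_edge p hp, h.apply_eq hq (α p k') (w p k), h.height_edge p hp, zero_mul, zero_add]
  have hex : ∀ k, k ≠ i → ∃ l, l ≠ j ∧ 0 < α p k (w q l) ∧
      ∀ k', k' ≠ i → k' ≠ k → α p k' (w q l) = 0 := by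
    intro k hk
    obtain ⟨l, -, hl⟩ : ∃ l ∈ univ, 0 < α q l (w p k) * α p k (w q l) := by
      refine (Finset.sum_pos_iff_of_nonneg fun l _ => hprod k k hk l).1 ?_
      rw [hsum]; simp
    refine ⟨l, ?_, ?_, fun k' hk' hkk' => ?_⟩
    · rintro rfl
      rw [hpj k hk, mul_zero] at hl
      exact hl.false
    · exact lt_of_le_of_ne (h.coord_edge_nonneg hp hq (h0 k hk) l) (right_ne_zero_of_mul hl.ne').symm
    · have h1 := hsum k k'
      rw [if_neg hkk', Finset.sum_eq_zero_iff_of_nonneg fun l _ => hprod k k' hk' l] at h1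
      exact (mul_eq_zero.1 (h1 l (mem_univ l))).resolve_left (left_ne_zero_of_mul hl.ne')
  choose! s hsj hspos hszero using hex
  let f : Fin n → Fin n := fun k => if k = i then j else s k
  have hfi : f i = j := if_pos rfl
  have hfk : ∀ k, k ≠ i → f k = s k := fun k hk => if_neg hk
  have hinj : Function.Injective f := by
    intro k k' hkk'
    by_cases hk : k = i <;> by_cases hk' : k' = i
    · rw [hk, hk']
    · rw [hk, hfi, hfk k' hk'] at hkk'
      exact absurd hkk'.symm (hsj k' hk')
    · rw [hk', hfi, hfk k hk] at hkk'
      exact absurd hkk' (hsj k hk)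
    · rw [hfk k hk, hfk k' hk'] at hkk'
      by_contra hne
      have := hspos k hk
      rw [hkk', hszero k' hk' k hk hne] at this
      exact this.false
  let σ : Equiv.Perm (Fin n) := Equiv.ofBijective f (Finite.injective_iff_bijective.1 hinj)
  have hσi : σ i = j := hfi
  have hσk : ∀ k, k ≠ i → σ k = s k := hfk
  refine ⟨σ, ?_, ?_, fun k hk => ⟨α p k (w q (σ k)), ?_, ⟨α p i (w q (σ k)), ?_⟩, fun x => ?_⟩⟩
  · rw [hσi]; exact ⟨hj, hj0⟩
  · rw [hσi]; exact hopp
  · rw [hσk k hk]; exact hspos k hk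
  · conv_lhs => rw [h.expand_of_height_eq_zero hp (h.height_edge q hq (σ k))]
    refine Fintype.sum_eq_add k i hk fun k' hk' => ?_
    rw [hσk k hk, hszero k hk k' hk'.2 hk'.1, zero_smul]
  · rw [h.apply_eq hq (α p k) x, h0 k hk, mul_zero, zero_add, mul_comm]
    refine Fintype.sum_eq_single (σ k) fun l hl => ?_
    obtain ⟨k', rfl⟩ := σ.surjective l
    have hkk' : k ≠ k' := fun hc => hl (by rw [hc])
    by_cases hk' : k' = i
    · rw [hk', hσi, hpj k hk, mul_zero]
    · rw [hσk k' hk', hszero k' hk' k hk hkk', mul_zero]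

theorem endpoint_unique (h : IsSimplePolytopeData R V w α) {p q q' : E} (hp : p ∈ V)
    (hq : q ∈ V) (hq' : q' ∈ V) {i : Fin n} (hi : 0 < α p i q) (h0 : ∀ k, k ≠ i → α p k q = 0)
    (hi' : 0 < α p i q') (h0' : ∀ k, k ≠ i → α p k q' = 0) : q = q' := by
  obtain ⟨j, hj, hj0, -, a, ha, haj⟩ := h.exists_opposite_edge hp hq hi h0
  obtain ⟨j', hj', hj0', -, a', ha', haj'⟩ := h.exists_opposite_edge hp hq' hi' h0'
  have e := h.eq_add_smul_edge hp hq h0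
  have e' := h.eq_add_smul_edge hp hq' h0'
  have key : ∀ {q q' : E}, q ∈ V → q' ∈ V → ∀ {j : Fin n} {a r r' : ℝ}, 0 < a →
      w q j = -a • w p i → q = p + r • w p i → q' = p + r' • w p i → r' ≤ r := by
    intro q q' hq hq' j a r r' ha haj e e'
    have h1 : α q j (w q j) = -a * α q j (w p i) := by rw [haj, map_smul, smul_eq_mul]
    rw [h.coord_edge q hq, if_pos rfl] at h1
    have h2 : q' = q + (r' - r) • w p i := by rw [e, e']; module
    have h3 := h.coord_nonneg q hq q' hq' j
    rw [h2, map_add, h.coord_self q hq, map_smul, smul_eq_mul, zero_add] at h3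
    have : α q j (w p i) < 0 := by
      by_contra! hc
      nlinarith [mul_nonneg ha.le hc]
    by_contra! hc
    nlinarith [mul_pos_of_neg_of_neg this (sub_neg.2 hc)]
  have : α p i q = α p i q' :=
    le_antisymm (key hq' hq ha' haj' e' e) (key hq hq' ha haj e e')
  rw [e, e', this]

theorem prod_polarFactor_sub {p : E} {ξ δ : Dual ℝ E} {i : Fin n} (hi : ξ (w p i) = 0)
    (hne : ∀ k, i ≠ k → ξ (w p k) ≠ 0) (hδ : δ (w p i) ≠ 0) (x : E) :
    ∏ k, polarFactor (LexPos ξ δ (w p k)) (α p k x) -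
      ∏ k, polarFactor (LexPos ξ (-δ) (w p k)) (α p k x) =
    (if 0 < δ (w p i) then -1 else 1) *
      ∏ k ∈ univ.erase i, polarFactor (0 < ξ (w p k)) (α p k x) := by
  have hrest : ∀ δ' : Dual ℝ E,
      ∏ k ∈ univ.erase i, polarFactor (LexPos ξ δ' (w p k)) (α p k x) =
        ∏ k ∈ univ.erase i, polarFactor (0 < ξ (w p k)) (α p k x) := by
    intro δ'
    refine Finset.prod_congr rfl fun k hk => ?_
    have : ξ (w p k) ≠ 0 := hne k (Finset.ne_of_mem_erase hk).symm
    rw [show LexPos ξ δ' (w p k) = (0 < ξ (w p k)) by simp [LexPos, this]]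
  rw [← Finset.mul_prod_erase univ _ (mem_univ i), ← Finset.mul_prod_erase univ _ (mem_univ i),
    hrest, hrest, ← sub_mul]
  congr 1
  have hpos : LexPos ξ δ (w p i) = (0 < δ (w p i)) := by simp [LexPos, hi]
  have hneg : LexPos ξ (-δ) (w p i) = (δ (w p i) < 0) := by simp [LexPos, hi]
  rw [hpos, hneg]
  rcases lt_or_gt_of_ne hδ with hlt | hgt
  · rw [if_neg hlt.not_gt, eq_false hlt.not_gt, eq_true hlt, ← neg_sub, polarFactor_sub, neg_neg]
  · rw [if_pos hgt, eq_true hgt, eq_false hgt.not_gt, polarFactor_sub]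

/-- Crossing a wall on which at most one edge vector at each vertex vanishes does not change the
polar sum. -/
theorem polarSum_lexPos_neg (h : IsSimplePolytopeData R V w α) {ξ δ : Dual ℝ E}
    (hgen : ∀ p ∈ V, ∀ k l, k ≠ l → ξ (w p k) = 0 → ξ (w p l) ≠ 0)
    (hδ : ∀ p ∈ V, ∀ k, ξ (w p k) = 0 → δ (w p k) ≠ 0) (x : E) :
    polarSum V w α (LexPos ξ δ) x = polarSum V w α (LexPos ξ (-δ)) x := by
  have hex : ∀ p ∈ V, ∃ q ∈ V,
      (∀ i, ξ (w p i) = 0 → 0 < α p i q ∧ ∀ k, k ≠ i → α p k q = 0) ∧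
      ((∀ i, ξ (w p i) ≠ 0) → q = p) := by
    intro p hp
    by_cases hz : ∃ i, ξ (w p i) = 0
    · obtain ⟨i, hi⟩ := hz
      obtain ⟨q, hq, hq'⟩ := h.exists_endpoint hp i
      refine ⟨q, hq, fun i' hi' => ?_, fun hc => absurd hi (hc i)⟩
      have : i' = i := by
        by_contra hne
        exact hgen p hp i' i hne hi' hi
      rwa [this]
    · push Not at hz
      exact ⟨p, hp, fun i hi => absurd hi (hz i), fun _ => rfl⟩
  choose! g hgV hg hg0 using hex
  unfold polarSum
  rw [← sub_eq_zero, ← Finset.sum_sub_distrib]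
  have hvanish : ∀ p ∈ V, (∀ i, ξ (w p i) ≠ 0) →
      ∏ k, polarFactor (LexPos ξ δ (w p k)) (α p k x) -
        ∏ k, polarFactor (LexPos ξ (-δ) (w p k)) (α p k x) = 0 := by
    intro p _ hz
    simp [LexPos, hz]
  refine Finset.sum_involution (fun p _ => g p) (fun p hp => ?_) (fun p hp hne => ?_)
    (fun p hp => hgV p hp) (fun p hp => ?_)
  · by_cases hz : ∃ i, ξ (w p i) = 0
    · obtain ⟨i, hi⟩ := hz
      obtain ⟨hpos, hzero⟩ := hg p hp i hi
      obtain ⟨σ, -, ⟨a, ha, haw⟩, hσ⟩ := h.exists_perm hp (hgV p hp) hpos hzero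
      have hσi : ξ (w (g p) (σ i)) = 0 := by rw [haw, map_smul, hi, smul_zero]
      rw [prod_polarFactor_sub hi (fun k hk => hgen p hp i k hk hi) (hδ p hp i hi),
        prod_polarFactor_sub hσi (fun k hk => hgen _ (hgV p hp) _ k hk hσi)
          (hδ _ (hgV p hp) _ hσi)]
      have hprod : ∏ k ∈ univ.erase (σ i), polarFactor (0 < ξ (w (g p) k)) (α (g p) k x) =
          ∏ k ∈ univ.erase i, polarFactor (0 < ξ (w p k)) (α p k x) := by
        symm
        refine Finset.prod_equiv σ (by simp) fun k hk => ?_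
        obtain ⟨b, hb, ⟨c, hc⟩, hx⟩ := hσ k (Finset.ne_of_mem_erase hk)
        have h1 : (0 < ξ (w (g p) (σ k))) = (0 < ξ (w p k)) := by
          rw [hc, map_add, map_smul, map_smul, hi, smul_zero, add_zero, smul_eq_mul,
            mul_pos_iff_of_pos_left hb]
        have h2 : (0 < α p k x) = (0 < α (g p) (σ k) x) := by
          rw [hx, mul_pos_iff_of_pos_left hb]
        unfold polarFactor
        simp only [h1, h2]
      rw [hprod, ← add_mul, haw, map_smul, smul_eq_mul]
      have hd := hδ p hp i hi
      rcases lt_or_gt_of_ne hd with hlt | hgt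
      · rw [if_neg hlt.not_gt, if_pos (by nlinarith)]; simp
      · rw [if_pos hgt, if_neg (by nlinarith)]; simp
    · push Not at hz
      rw [hg0 p hp hz, hvanish p hp hz, add_zero]
  · by_cases hz : ∃ i, ξ (w p i) = 0
    · obtain ⟨i, hi⟩ := hz
      obtain ⟨hpos, -⟩ := hg p hp i hi
      intro hc
      rw [hc, h.coord_self p hp] at hpos
      exact hpos.false
    · push Not at hz
      exact absurd (hvanish p hp hz) hne
  · by_cases hz : ∃ i, ξ (w p i) = 0
    · obtain ⟨i, hi⟩ := hz
      obtain ⟨hpos, hzero⟩ := hg p hp i hi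
      obtain ⟨σ, ⟨hs, hs0⟩, ⟨a, ha, haw⟩, -⟩ := h.exists_perm hp (hgV p hp) hpos hzero
      have hσi : ξ (w (g p) (σ i)) = 0 := by rw [haw, map_smul, hi, smul_zero]
      obtain ⟨hpos', hzero'⟩ := hg _ (hgV p hp) _ hσi
      exact h.endpoint_unique (hgV p hp) (hgV _ (hgV p hp)) hp hpos' hzero' hs hs0
    · push Not at hz
      rw [hg0 p hp hz, hg0 p hp hz]

/-- The polar sums of two polarizing vectors agree if the segment between them is generic. -/
theorem polarSum_eq_of_generic (h : IsSimplePolytopeData R V w α) {ξ₀ ξ₁ : Dual ℝ E}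
    (h₀ : ∀ p ∈ V, ∀ k, ξ₀ (w p k) ≠ 0) (h₁ : ∀ p ∈ V, ∀ k, ξ₁ (w p k) ≠ 0)
    (hgen : ∀ p ∈ V, ∀ k l, k ≠ l → ξ₁ (ξ₀ (w p k) • w p l - ξ₀ (w p l) • w p k) ≠ 0) (x : E) :
    polarSum V w α (fun u => 0 < ξ₀ u) x = polarSum V w α (fun u => 0 < ξ₁ u) x := by
  set δ := ξ₁ - ξ₀ with hδ
  let F : ℝ → ℝ := fun t => polarSum V w α (LexPos (ξ₀ + t • δ) δ) x
  have hval : ∀ (t : ℝ) u, (ξ₀ + t • δ) u = (1 - t) * ξ₀ u + t * ξ₁ u := by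
    intro t u
    simp only [hδ, LinearMap.add_apply, LinearMap.smul_apply, LinearMap.sub_apply, smul_eq_mul]
    ring
  have hδne : ∀ t : ℝ, ∀ p ∈ V, ∀ k, (ξ₀ + t • δ) (w p k) = 0 → δ (w p k) ≠ 0 := by
    intro t p hp k hz hd
    rw [LinearMap.add_apply, LinearMap.smul_apply, hd, smul_zero, add_zero] at hz
    exact h₀ p hp k hz
  have hwall : ∀ t, F t = polarSum V w α (LexPos (ξ₀ + t • δ) (-δ)) x := by
    intro t
    refine h.polarSum_lexPos_neg (fun p hp k l hkl hk hl => ?_) (hδne t) x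
    rw [hval] at hk hl
    have h2 : (1 - t) * (ξ₀ (w p k) * ξ₁ (w p l) - ξ₀ (w p l) * ξ₁ (w p k)) = 0 := by
      linear_combination ξ₁ (w p l) * hk - ξ₁ (w p k) * hl
    rcases mul_eq_zero.1 h2 with ht | h3
    · have ht' : t = 1 := by linarith
      rw [ht'] at hk
      exact h₁ p hp k (by linarith)
    · refine hgen p hp k l hkl ?_
      simpa using h3
  have hloc : IsLocallyConstant F := by
    rw [IsLocallyConstant.iff_eventually_eq]
    intro t
    have hev : ∀ᶠ s in nhds t, ∀ p ∈ V, ∀ k,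
        (t ≤ s → (LexPos (ξ₀ + s • δ) δ (w p k) ↔ LexPos (ξ₀ + t • δ) δ (w p k))) ∧
        (s < t → (LexPos (ξ₀ + s • δ) δ (w p k) ↔ LexPos (ξ₀ + t • δ) (-δ) (w p k))) := by
      rw [Filter.eventually_all_finset]
      intro p hp
      rw [Filter.eventually_all]
      intro k
      have hcont : Continuous fun s : ℝ => (ξ₀ + s • δ) (w p k) := by
        simp only [LinearMap.add_apply, LinearMap.smul_apply, smul_eq_mul]
        fun_prop
      rcases lt_trichotomy ((ξ₀ + t • δ) (w p k)) 0 with hlt | heq | hgt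
      · filter_upwards [hcont.continuousAt.eventually_lt_const hlt] with s hs
        simp only [LexPos, hlt.ne, hlt.not_gt, hs.ne, hs.not_gt, false_and, or_false, implies_true,
          and_self]
      · refine Filter.Eventually.of_forall fun s => ?_
        have hd := hδne t p hp k heq
        have hs : (ξ₀ + s • δ) (w p k) = (s - t) * δ (w p k) := by
          simp only [LinearMap.add_apply, LinearMap.smul_apply, smul_eq_mul] at heq ⊢
          linear_combination heq
        simp only [LexPos, heq, hs, lt_irrefl, false_or, true_and, LinearMap.neg_apply,
          mul_eq_zero, hd, or_false, sub_eq_zero]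
        refine ⟨fun hts => ?_, fun hst => ?_⟩
        · rcases hts.eq_or_lt with rfl | hts
          · simp
          · simp [mul_pos_iff_of_pos_left (sub_pos.2 hts), hts.ne']
        · have : (s - t) < 0 := sub_neg.2 hst
          simp only [hst.ne, false_and, or_false, Left.neg_pos_iff]
          exact ⟨fun hm => by by_contra! hc; nlinarith [mul_nonneg (neg_nonneg.2 this.le) hc],
            fun hm => mul_pos_of_neg_of_neg this hm⟩
      · filter_upwards [hcont.continuousAt.eventually_const_lt hgt] with s hs
        simp only [LexPos, hgt, hs, true_or, implies_true, and_self]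
    filter_upwards [hev] with s hs
    rcases le_or_gt t s with hts | hst
    · exact polarSum_congr fun p hp k => (hs p hp k).1 hts
    · rw [hwall t]
      exact polarSum_congr fun p hp k => (hs p hp k).2 hst
  have hF : F 0 = F 1 := hloc.apply_eq_of_preconnectedSpace 0 1
  have hF0 : F 0 = polarSum V w α (fun u => 0 < ξ₀ u) x :=
    polarSum_congr fun p hp k => by simp [LexPos, h₀ p hp k]
  have hF1 : F 1 = polarSum V w α (fun u => 0 < ξ₁ u) x :=
    polarSum_congr fun p hp k => by simp [LexPos, hδ, h₁ p hp k]
  rw [← hF0, hF, hF1]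

/-- A polarizing vector may be replaced, without changing the polar sum, by one that refines the
signs of a given functional. -/
theorem exists_polarSum_eq (h : IsSimplePolytopeData R V w α) {ξ : Dual ℝ E}
    (hξ : ∀ p ∈ V, ∀ k, ξ (w p k) ≠ 0) (η : Dual ℝ E) (x : E) :
    ∃ ξ' : Dual ℝ E,
      polarSum V w α (fun u => 0 < ξ u) x = polarSum V w α (fun u => 0 < ξ' u) x ∧
      ∀ p ∈ V, ∀ k, ξ' (w p k) ≠ 0 ∧ (0 < η (w p k) → 0 < ξ' (w p k)) ∧
        (η (w p k) < 0 → ξ' (w p k) < 0) := by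
  let v : ((V × Fin n) ⊕ {t : V × Fin n × Fin n // t.2.1 ≠ t.2.2}) → E :=
    Sum.elim (fun t => w t.1 t.2) fun t =>
      ξ (w t.1.1 t.1.2.1) • w t.1.1 t.1.2.2 - ξ (w t.1.1 t.1.2.2) • w t.1.1 t.1.2.1
  have hv : ∀ i, v i ≠ 0 := by
    rintro (⟨⟨p, hp⟩, k⟩ | ⟨⟨⟨p, hp⟩, k, l⟩, hkl⟩)
    · exact h.edge_ne_zero hp k
    · intro h0
      have := congrArg (α p l) h0
      simp only [v, Sum.elim_inr, map_sub, map_smul, map_zero, h.coord_edge p hp, if_true,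
        if_neg (Ne.symm hkl), smul_eq_mul, mul_one, mul_zero, sub_zero] at this
      exact hξ p hp k this
  obtain ⟨ξ', hξ'⟩ := exists_dual_refining_signs η v hv
  refine ⟨ξ', ?_, fun p hp k => hξ' (Sum.inl (⟨p, hp⟩, k))⟩
  exact h.polarSum_eq_of_generic hξ (fun p hp k => (hξ' (Sum.inl (⟨p, hp⟩, k))).1)
    (fun p hp k l hkl => (hξ' (Sum.inr ⟨(⟨p, hp⟩, k, l), hkl⟩)).1) x

/-- The polar sum vanishes at points separated from the cone or its opposite by a functional. -/
theorem polarSum_eq_zero (h : IsSimplePolytopeData R V w α) {ξ : Dual ℝ E}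
    (hξ : ∀ p ∈ V, ∀ k, ξ (w p k) ≠ 0) {x : E} (η : Dual ℝ E)
    (hη : ∀ p ∈ V, η x ≤ R x * η p)
    (hη' : (∀ p ∈ V, η x ≠ R x * η p) ∨ (0 < R x ∧ ∃ u, R u = 0 ∧ η u ≠ 0)) :
    polarSum V w α (fun u => 0 < ξ u) x = 0 := by
  obtain ⟨ξ', heq, hξ'⟩ := h.exists_polarSum_eq hξ η x
  rw [heq]
  refine Finset.sum_eq_zero fun p hp => ?_
  by_contra hne
  rw [← ne_eq, Finset.prod_ne_zero_iff] at hne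
  have hsgn : ∀ k, 0 < ξ' (w p k) ↔ 0 < α p k x := fun k =>
    polarFactor_ne_zero_iff.1 (hne k (mem_univ k))
  have hnn : ∀ k ∈ univ, 0 ≤ α p k x * η (w p k) := by
    intro k _
    obtain ⟨-, hpos, hneg⟩ := hξ' p hp k
    rcases lt_trichotomy (η (w p k)) 0 with hlt | h0 | hgt
    · exact mul_nonneg_of_nonpos_of_nonpos
        (not_lt.1 fun hc => (hneg hlt).not_gt ((hsgn k).2 hc)) hlt.le
    · rw [h0, mul_zero]
    · exact (mul_pos ((hsgn k).1 (hpos hgt)) hgt).le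
  have happ := h.apply_eq hp η x
  have heq0 : η x = R x * η p := le_antisymm (hη p hp) (by linarith [Finset.sum_nonneg hnn])
  rcases hη' with hη' | ⟨hR, u, hu, hηu⟩
  · exact hη' p hp heq0
  · have hsum : ∑ k, α p k x * η (w p k) = 0 := by linarith
    rw [Finset.sum_eq_zero_iff_of_nonneg hnn] at hsum
    have hedge : ∀ k, 0 ≤ η (w p k) := h.edge_nonneg_of_isMin hp fun v hv => by
      have := hη v hv
      rw [heq0] at this
      exact le_of_mul_le_mul_left this hR
    have hzero : ∀ k, η (w p k) = 0 := by
      intro k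
      by_contra hk
      have hpos := lt_of_le_of_ne (hedge k) (Ne.symm hk)
      have := mul_pos ((hsgn k).1 ((hξ' p hp k).2.1 hpos)) hpos
      exact this.ne' (hsum k (mem_univ k))
    apply hηu
    rw [h.apply_eq hp η u, hu]
    simp [hzero]

theorem polarSum_eq_one (h : IsSimplePolytopeData R V w α) (hV : V.Nonempty) {ξ : Dual ℝ E}
    (hξ : ∀ p ∈ V, ∀ k, ξ (w p k) ≠ 0) {x : E} (hx : ∀ p ∈ V, ∀ k, α p k x ≤ 0) :
    polarSum V w α (fun u => 0 < ξ u) x = 1 := by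
  obtain ⟨p, hp, hneg, huniq⟩ := h.existsUnique_isMax hV hξ
  unfold polarSum
  rw [Finset.sum_eq_single_of_mem p hp fun q hq hqp => ?_]
  · refine Finset.prod_eq_one fun k _ => ?_
    simp [polarFactor, (hneg k).not_gt, (hx p hp k).not_gt]
  · by_contra hne
    rw [← ne_eq, Finset.prod_ne_zero_iff] at hne
    refine hqp (huniq q hq fun k => lt_of_le_of_ne (not_lt.1 fun hc => ?_) (hξ q hq k))
    exact (hx q hq k).not_gt ((polarFactor_ne_zero_iff.1 (hne k (mem_univ k))).1 hc)

theorem polarSum_eq_neg_one_pow (h : IsSimplePolytopeData R V w α) (hV : V.Nonempty)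
    {ξ : Dual ℝ E} (hξ : ∀ p ∈ V, ∀ k, ξ (w p k) ≠ 0) {x : E}
    (hx : ∀ p ∈ V, ∀ k, 0 < α p k x) :
    polarSum V w α (fun u => 0 < ξ u) x = (-1) ^ n := by
  obtain ⟨p, hp, hpos, huniq⟩ := h.existsUnique_isMax hV (ξ := -ξ) (by simpa using hξ)
  simp only [LinearMap.neg_apply, Left.neg_neg_iff] at hpos huniq
  unfold polarSum
  rw [Finset.sum_eq_single_of_mem p hp fun q hq hqp => ?_]
  · simp [polarFactor, hpos, hx p hp]
  · by_contra hne
    rw [← ne_eq, Finset.prod_ne_zero_iff] at hne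
    exact hqp (huniq q hq fun k => (polarFactor_ne_zero_iff.1 (hne k (mem_univ k))).2 (hx q hq k))

theorem signed_indicator_eq_prod (h : IsSimplePolytopeData R V w α) {ξ : Dual ℝ E} {p : E}
    (hp : p ∈ V) (hξ : ∀ k, ξ (w p k) ≠ 0) (x : E) :
    (-1 : ℝ) ^ Nat.card {i : Fin n // 0 < ξ (w p i)} *
      Set.indicator
        {y : E | ∃ c : Fin n → ℝ,
          (∀ i, 0 < ξ (w p i) → 0 < c i) ∧
          (∀ i, ξ (w p i) < 0 → c i ≤ 0) ∧
          ∃ s : ℝ, y = p + (∑ i, c i • w p i) + s • p}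
        (fun _ => (1 : ℝ)) x = ∏ k, polarFactor (0 < ξ (w p k)) (α p k x) := by
  classical
  by_cases hx : ∀ k, 0 < ξ (w p k) ↔ 0 < α p k x
  · rw [Set.indicator_of_mem, mul_one]
    · have : ∀ k ∈ univ, polarFactor (0 < ξ (w p k)) (α p k x) =
          if 0 < ξ (w p k) then -1 else 1 := by
        intro k _
        by_cases hk : 0 < ξ (w p k)
        · simp [polarFactor, hk, (hx k).1 hk]
        · simp [polarFactor, hk, mt (hx k).2 hk]
      rw [Finset.prod_congr rfl this, Finset.prod_ite, Finset.prod_const, Finset.prod_const_one,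
        mul_one, Nat.card_eq_fintype_card, Fintype.card_subtype]
    · refine ⟨fun k => α p k x, fun k => (hx k).1,
        fun k hk => not_lt.1 fun hc => hk.not_gt ((hx k).2 hc), R x - 1, ?_⟩
      conv_lhs => rw [h.expand p hp x]
      module
  · rw [Set.indicator_of_notMem, mul_zero]
    · symm
      by_contra hne
      rw [← ne_eq, Finset.prod_ne_zero_iff] at hne
      exact hx fun k => polarFactor_ne_zero_iff.1 (hne k (mem_univ k))
    · rintro ⟨c, hpos, hneg, s, rfl⟩
      refine hx fun k => ?_
      have : α p k (p + (∑ i, c i • w p i) + s • p) = c k := by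
        simp [h.coord_self p hp, h.coord_edge p hp]
      rw [this]
      rcases lt_or_gt_of_ne (hξ k) with hlt | hgt
      · simp [hlt.not_gt, hneg k hlt]
      · simp [hgt, hpos k hgt]

end IsSimplePolytopeData

/-- Coordinates relative to a basis of the form `p, w₁, …, wₙ`, where `R p = 1` and the `wᵢ` span
the kernel of `R`. -/
theorem exists_coordinates {E : Type*} [AddCommGroup E] [Module ℝ E] {n : ℕ} {R : Dual ℝ E} {p : E}
    {w : Fin n → E} (hp : R p = 1) (hli : LinearIndependent ℝ w)
    (hspan : Submodule.span ℝ (Set.range w) = LinearMap.ker R) :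
    ∃ α : Fin n → Dual ℝ E, (∀ x, x = R x • p + ∑ k, α k x • w k) ∧
      (∀ k l, α k (w l) = if k = l then 1 else 0) ∧ ∀ k, α k p = 0 := by
  let π : E →ₗ[ℝ] Submodule.span ℝ (Set.range w) :=
    LinearMap.codRestrict _ (LinearMap.id - R.smulRight p) fun x => by
      rw [hspan, LinearMap.mem_ker]
      simp [hp]
  have hπ : ∀ x, (π x : E) = x - R x • p := fun x => rfl
  refine ⟨fun k => Finsupp.lapply k ∘ₗ hli.repr ∘ₗ π, fun x => ?_, fun k l => ?_,
    fun k => ?_⟩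
  · have h1 := hli.linearCombination_repr (π x)
    rw [hπ, Finsupp.linearCombination_apply,
      Finsupp.sum_fintype _ _ (by simp)] at h1
    exact (add_eq_of_eq_sub' h1).symm
  · have hw : R (w l) = 0 := by
      rw [← LinearMap.mem_ker, ← hspan]
      exact Submodule.subset_span ⟨l, rfl⟩
    have h1 : hli.repr (π (w l)) = Finsupp.single l 1 :=
      hli.repr_eq_single l _ (by rw [hπ, hw, zero_smul, sub_zero])
    simp [h1, Finsupp.single_apply, eq_comm]
  · have h1 : π p = 0 := Subtype.ext (by rw [hπ, hp, one_smul, sub_self]; rfl)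
    simp [h1]

theorem exists_isSimplePolytopeData {E : Type*} [AddCommGroup E] [Module ℝ E] {n : ℕ}
    {R : Dual ℝ E} {P : Set E} (hPH : ∀ η ∈ P, R η = 1) {V : Finset E} {w : E → Fin n → E}
    (hPhull : P = convexHull ℝ (V : Set E))
    (hw0 : ∀ p ∈ V, ∀ i, R (w p i) = 0)
    (hindep : ∀ p ∈ V, LinearIndependent ℝ (w p))
    (hspan : ∀ p ∈ V, Submodule.span ℝ (Set.range (w p)) = LinearMap.ker R)
    (htangent : ∀ p ∈ V,
      {y : E | ∃ r : ℝ, 0 ≤ r ∧ ∃ x ∈ P, y = p + r • (x - p)} =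
        {y : E | ∃ c : Fin n → ℝ, (∀ i, 0 ≤ c i) ∧ y = p + ∑ i, c i • w p i}) :
    ∃ α : E → Fin n → Dual ℝ E, IsSimplePolytopeData R V w α := by
  have hVP : ∀ p ∈ V, p ∈ P := fun p hp => by
    rw [hPhull]; exact subset_convexHull ℝ _ hp
  have hV1 : ∀ p ∈ V, R p = 1 := fun p hp => hPH p (hVP p hp)
  have hex : ∀ p ∈ V, ∃ α : Fin n → Dual ℝ E, (∀ x, x = R x • p + ∑ k, α k x • w p k) ∧
      (∀ k l, α k (w p l) = if k = l then 1 else 0) ∧ ∀ k, α k p = 0 :=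
    fun p hp => exists_coordinates (hV1 p hp) (hindep p hp) (hspan p hp)
  choose! α hexp hcoord hself using hex
  refine ⟨α, hV1, hw0, hexp, hcoord, hself, fun p hp q hq k => ?_, fun p hp k => ?_⟩
  · have hmem : q ∈ {y : E | ∃ r : ℝ, 0 ≤ r ∧ ∃ x ∈ P, y = p + r • (x - p)} :=
      ⟨1, zero_le_one, q, hVP q hq, by simp⟩
    rw [htangent p hp] at hmem
    obtain ⟨c, hc, rfl⟩ := hmem
    simpa [hself p hp, hcoord p hp] using hc k
  · have hmem : p + w p k ∈ {y : E | ∃ c : Fin n → ℝ, (∀ i, 0 ≤ c i) ∧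
        y = p + ∑ i, c i • w p i} := by
      refine ⟨Pi.single k 1, fun i => ?_, ?_⟩
      · by_cases hi : i = k
        · subst hi; simp
        · simp [hi]
      · simp [Pi.single_apply]
    rw [← htangent p hp] at hmem
    obtain ⟨r, hr, y, hy, heq⟩ := hmem
    rw [hPhull, Finset.mem_convexHull'] at hy
    obtain ⟨a, ha, ha1, rfl⟩ := hy
    refine ⟨fun v => r * a v, fun v hv => mul_nonneg hr (ha v hv), ?_⟩
    rw [add_left_cancel heq]
    simp_rw [mul_smul, ← Finset.smul_sum, smul_sub, Finset.sum_sub_distrib, ← Finset.sum_smul, ha1,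
      one_smul, smul_sub]

end SimplePolytope

theorem mem_neg_coneOver_iff {E : Type*} [AddCommGroup E] [Module ℝ E] {P : Set E} {x : E} :
    x ∈ -coneOver P ↔ ∃ r : ℝ, r ≤ 0 ∧ ∃ η ∈ P, x = r • η := by
  rw [Set.mem_neg]
  constructor
  · rintro ⟨r, hr, η, hη, hx⟩
    exact ⟨-r, by simpa using hr, η, hη, by rw [neg_smul, ← hx, neg_neg]⟩
  · rintro ⟨r, hr, η, hη, rfl⟩
    exact ⟨-r, by simpa using hr, η, hη, by rw [neg_smul]⟩

/-- A nonzero functional that is nonnegative on a set is positive on its interior. -/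
theorem pos_of_mem_interior {E : Type*} [NormedAddCommGroup E] [NormedSpace ℝ E]
    {s : Set E} {f : Dual ℝ E} (hf : ∀ y ∈ s, 0 ≤ f y) {u : E} (hu : f u ≠ 0) {x : E}
    (hx : x ∈ interior s) : 0 < f x := by
  have hcont : Continuous fun t : ℝ => x - (t * f u) • u := by fun_prop
  have hnhds : s ∈ nhds (x - ((0 : ℝ) * f u) • u) := by
    rw [zero_mul, zero_smul, sub_zero]
    exact mem_interior_iff_mem_nhds.1 hx
  have hev : ∀ᶠ t in nhdsWithin (0 : ℝ) (Set.Ioi 0), x - (t * f u) • u ∈ s :=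
    (hcont.continuousAt.eventually_mem hnhds).filter_mono nhdsWithin_le_nhds
  obtain ⟨t, ht, ht0⟩ := (hev.and self_mem_nhdsWithin).exists
  have h1 := hf _ ht
  rw [map_sub, map_smul, smul_eq_mul] at h1
  have h2 : 0 < t * f u * f u := by
    rw [mul_assoc]
    exact mul_pos ht0 (mul_self_pos.2 hu)
  linarith

section Cone

variable {E : Type*} [NormedAddCommGroup E] [NormedSpace ℝ E] {n : ℕ} {R : Dual ℝ E} {V : Finset E}
  {w : E → Fin n → E} {α : E → Fin n → Dual ℝ E}

namespace IsSimplePolytopeData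

theorem apply_le_of_mem_convexHull {f : Dual ℝ E} {c : ℝ} (hf : ∀ v ∈ V, c ≤ f v) {y : E}
    (hy : y ∈ convexHull ℝ (V : Set E)) : c ≤ f y :=
  convexHull_min (t := {z | c ≤ f z}) hf (convex_halfSpace_ge f.isLinear c) hy

/-- The polar sum vanishes off the cone and its opposite. -/
theorem polarSum_eq_zero_of_notMem (h : IsSimplePolytopeData R V w α) {ξ : Dual ℝ E}
    (hξ : ∀ p ∈ V, ∀ k, ξ (w p k) ≠ 0) {x : E}
    (hC : x ∉ coneOver (convexHull ℝ (V : Set E)))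
    (hC' : x ∉ -coneOver (convexHull ℝ (V : Set E))) :
    polarSum V w α (fun u => 0 < ξ u) x = 0 := by
  rcases V.eq_empty_or_nonempty with rfl | ⟨v, hv⟩
  · simp [polarSum]
  have hvP : v ∈ convexHull ℝ (V : Set E) := subset_convexHull ℝ _ hv
  have hconv : Convex ℝ (convexHull ℝ (V : Set E)) := convex_convexHull ℝ _
  have hclosed : IsClosed (convexHull ℝ (V : Set E)) :=
    V.finite_toSet.isClosed_convexHull ℝ
  suffices ∃ η : Dual ℝ E, ∀ p ∈ V, η x < R x * η p by
    obtain ⟨η, hη⟩ := this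
    exact h.polarSum_eq_zero hξ η (fun p hp => (hη p hp).le) (Or.inl fun p hp => (hη p hp).ne)
  rcases eq_or_ne (R x) 0 with hR | hR
  · have hx : x ≠ 0 := by
      rintro rfl
      exact hC ⟨0, le_rfl, v, hvP, (zero_smul ℝ v).symm⟩
    obtain ⟨f, hf⟩ := geometric_hahn_banach_point_point hx
    refine ⟨f.toLinearMap, fun p _ => ?_⟩
    rw [hR, zero_mul]
    simpa using hf
  · have hx : x = R x • (R x)⁻¹ • x := by rw [smul_inv_smul₀ hR]
    have hnot : (R x)⁻¹ • x ∉ convexHull ℝ (V : Set E) := by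
      intro hmem
      rcases le_total 0 (R x) with hle | hle
      · exact hC ⟨R x, hle, _, hmem, hx⟩
      · exact hC' (mem_neg_coneOver_iff.2 ⟨R x, hle, _, hmem, hx⟩)
    rcases lt_or_gt_of_ne hR with hlt | hgt
    · obtain ⟨f, u, hu, hfx⟩ := geometric_hahn_banach_closed_point hconv hclosed hnot
      refine ⟨f.toLinearMap, fun p hp => ?_⟩
      have h1 := (hu p (subset_convexHull ℝ _ hp)).trans hfx
      have h2 : f x = R x * f ((R x)⁻¹ • x) := by
        rw [map_smul, smul_eq_mul, mul_inv_cancel_left₀ hR]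
      change f x < R x * f p
      rw [h2]
      exact mul_lt_mul_of_neg_left h1 hlt
    · obtain ⟨f, u, hfx, hu⟩ := geometric_hahn_banach_point_closed hconv hclosed hnot
      refine ⟨f.toLinearMap, fun p hp => ?_⟩
      have h1 := hfx.trans (hu p (subset_convexHull ℝ _ hp))
      have h2 : f x = R x * f ((R x)⁻¹ • x) := by
        rw [map_smul, smul_eq_mul, mul_inv_cancel_left₀ hR]
      change f x < R x * f p
      rw [h2]
      exact mul_lt_mul_of_pos_left h1 hgt

theorem height_coneOver_nonneg (h : IsSimplePolytopeData R V w α) {x : E}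
    (hx : x ∈ coneOver (convexHull ℝ (V : Set E))) : 0 ≤ R x := by
  obtain ⟨r, hr, η, hη, rfl⟩ := hx
  rw [map_smul, smul_eq_mul]
  exact mul_nonneg hr (apply_le_of_mem_convexHull (fun v hv => by
    rw [h.height_vertex v hv]; exact zero_le_one) hη)

theorem coord_coneOver_nonneg (h : IsSimplePolytopeData R V w α) {p : E} (hp : p ∈ V) (k : Fin n)
    {x : E} (hx : x ∈ coneOver (convexHull ℝ (V : Set E))) : 0 ≤ α p k x := by
  obtain ⟨r, hr, η, hη, rfl⟩ := hx
  rw [map_smul, smul_eq_mul]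
  exact mul_nonneg hr (apply_le_of_mem_convexHull (fun v hv => h.coord_nonneg p hp v hv k) hη)

/-- The interior of the cone is cut out by the facet inequalities. -/
theorem mem_interior_coneOver_iff [FiniteDimensional ℝ E] (h : IsSimplePolytopeData R V w α)
    (hV : V.Nonempty) {ξ : Dual ℝ E} (hξ : ∀ p ∈ V, ∀ k, ξ (w p k) ≠ 0) {x : E} :
    x ∈ interior (coneOver (convexHull ℝ (V : Set E))) ↔
      0 < R x ∧ ∀ p ∈ V, ∀ k, 0 < α p k x := by
  constructor
  · intro hx
    obtain ⟨v, hv⟩ := hV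
    refine ⟨pos_of_mem_interior (fun y hy => h.height_coneOver_nonneg hy) (u := v) ?_ hx,
      fun p hp k => pos_of_mem_interior (fun y hy => h.coord_coneOver_nonneg hp k hy)
        (u := w p k) ?_ hx⟩
    · rw [h.height_vertex v hv]; exact one_ne_zero
    · rw [h.coord_edge p hp, if_pos rfl]; exact one_ne_zero
  · rintro ⟨hR, hα⟩
    have hopen : ∀ᶠ y in nhds x, 0 < R y ∧ ∀ p ∈ V, ∀ k, 0 < α p k y := by
      refine Filter.Eventually.and ?_ ?_
      · exact R.continuous_of_finiteDimensional.continuousAt.eventually_const_lt hR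
      · rw [Filter.eventually_all_finset]
        intro p hp
        rw [Filter.eventually_all]
        intro k
        exact (α p k).continuous_of_finiteDimensional.continuousAt.eventually_const_lt (hα p hp k)
    rw [mem_interior_iff_mem_nhds]
    filter_upwards [hopen] with y ⟨hRy, hαy⟩
    by_contra hy
    have h0 := h.polarSum_eq_zero_of_notMem hξ hy fun hy' =>
      (h.height_coneOver_nonneg (Set.mem_neg.1 hy')).not_gt (by simpa using hRy)
    rw [h.polarSum_eq_neg_one_pow hV hξ hαy] at h0
    exact pow_ne_zero n (by norm_num) h0

theorem polarSum_eq (h : IsSimplePolytopeData R V w α) [FiniteDimensional ℝ E] {ξ : Dual ℝ E}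
    (hξ : ∀ p ∈ V, ∀ k, ξ (w p k) ≠ 0) (x : E) :
    polarSum V w α (fun u => 0 < ξ u) x =
      (-1 : ℝ) ^ n * Set.indicator (interior (coneOver (convexHull ℝ (V : Set E))))
        (fun _ => (1 : ℝ)) x +
      Set.indicator (-(coneOver (convexHull ℝ (V : Set E)))) (fun _ => (1 : ℝ)) x := by
  rcases V.eq_empty_or_nonempty with rfl | hV
  · simp [polarSum, coneOver]
  by_cases hneg : x ∈ -coneOver (convexHull ℝ (V : Set E))
  · have hxint : x ∉ interior (coneOver (convexHull ℝ (V : Set E))) := fun hc => by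
      have h1 := h.height_coneOver_nonneg (Set.mem_neg.1 hneg)
      rw [map_neg] at h1
      linarith [((h.mem_interior_coneOver_iff hV hξ).1 hc).1]
    rw [Set.indicator_of_notMem hxint, Set.indicator_of_mem hneg, mul_zero, zero_add]
    refine h.polarSum_eq_one hV hξ fun p hp k => ?_
    have h1 := h.coord_coneOver_nonneg hp k (Set.mem_neg.1 hneg)
    rwa [map_neg, neg_nonneg] at h1
  rw [Set.indicator_of_notMem hneg, add_zero]
  by_cases hxint : x ∈ interior (coneOver (convexHull ℝ (V : Set E)))
  · rw [Set.indicator_of_mem hxint, mul_one]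
    exact h.polarSum_eq_neg_one_pow hV hξ ((h.mem_interior_coneOver_iff hV hξ).1 hxint).2
  rw [Set.indicator_of_notMem hxint, mul_zero]
  by_cases hpos : x ∈ coneOver (convexHull ℝ (V : Set E))
  · have hR : 0 < R x := by
      refine lt_of_le_of_ne (h.height_coneOver_nonneg hpos) fun h0 => hneg ?_
      obtain ⟨r, hr, η, hη, rfl⟩ := hpos
      have h1 : 1 ≤ R η :=
        apply_le_of_mem_convexHull (fun v hv => (h.height_vertex v hv).ge) hη
      rw [map_smul, smul_eq_mul, eq_comm, mul_eq_zero] at h0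
      have h2 : r = 0 := h0.resolve_right (by linarith)
      exact mem_neg_coneOver_iff.2 ⟨r, h2.le, η, hη, rfl⟩
    have hex : ∃ p ∈ V, ∃ k, α p k x ≤ 0 := by
      by_contra! hc
      exact hxint ((h.mem_interior_coneOver_iff hV hξ).2 ⟨hR, hc⟩)
    obtain ⟨p, hp, k, hk⟩ := hex
    refine h.polarSum_eq_zero hξ (α p k)
      (fun q hq => hk.trans (mul_nonneg hR.le (h.coord_nonneg p hp q hq k)))
      (Or.inr ⟨hR, w p k, h.height_edge p hp k, ?_⟩)
    rw [h.coord_edge p hp, if_pos rfl]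
    exact one_ne_zero
  · exact h.polarSum_eq_zero_of_notMem hξ hpos hneg

end IsSimplePolytopeData

end Cone

/-- **Dual polar decomposition of a cone over a polytope in a hyperplane.**
`E` plays the role of the dual space `W*` of an `(n+1)`-dimensional real
vector space `W`; vectors `R, ξ ∈ W` are represented by the corresponding
functionals on `E` (via `W ≅ W**`), so that `⟨η, R⟩` becomes `R η`.
`P` is a simple convex polytope in the affine hyperplane `H = {η : R η = 1}`,
whose edge vectors at each vertex form a basis of the direction space
`ker R`, `C` is the cone over `P`, and `Ǩ_p^#(ξ) = Č_p^#(ξ) + ℝ p`.  For every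
polarizing vector `ξ` and every `x ∈ W*`:
`Σ_{p ∈ Vert} (−1)^{|E_p^+(ξ)|} 1_{Ǩ_p^#(ξ)}(x) = (−1)^n · 1_{C°}(x) + 1_{−C}(x)`. -/
theorem dual_polar_decomposition_cone_over_polytope_in_hyperplane
    {E : Type*} [NormedAddCommGroup E] [NormedSpace ℝ E] [FiniteDimensional ℝ E]
    {n : ℕ} (hdim : finrank ℝ E = n + 1)
    (R : Module.Dual ℝ E)
    (P : Set E) (hPH : ∀ η ∈ P, R η = 1)
    (Vert : Finset E) (w : E → Fin n → E)
    (hPcompact : IsCompact P)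
    (hPhull : P = convexHull ℝ (Vert : Set E))
    (hw0 : ∀ p ∈ Vert, ∀ i, R (w p i) = 0)
    (hindep : ∀ p ∈ Vert, LinearIndependent ℝ (w p))
    (hspan : ∀ p ∈ Vert, Submodule.span ℝ (Set.range (w p)) = LinearMap.ker R)
    (htangent : ∀ p ∈ Vert,
      {y : E | ∃ r : ℝ, 0 ≤ r ∧ ∃ x ∈ P, y = p + r • (x - p)} =
        {y : E | ∃ c : Fin n → ℝ, (∀ i, 0 ≤ c i) ∧ y = p + ∑ i, c i • w p i})
    (ξ : Module.Dual ℝ E)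
    (hpol : ∀ p ∈ Vert, ∀ i, ξ (w p i) ≠ 0)
    (x : E) :
    ∑ p ∈ Vert,
        (-1 : ℝ) ^ Nat.card {i : Fin n // 0 < ξ (w p i)} *
          Set.indicator
            {y : E | ∃ c : Fin n → ℝ,
              (∀ i, 0 < ξ (w p i) → 0 < c i) ∧
              (∀ i, ξ (w p i) < 0 → c i ≤ 0) ∧
              ∃ s : ℝ, y = p + (∑ i, c i • w p i) + s • p}
            (fun _ => (1 : ℝ)) x =
      (-1 : ℝ) ^ n * Set.indicator (interior (coneOver P)) (fun _ => (1 : ℝ)) x +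
        Set.indicator (-(coneOver P)) (fun _ => (1 : ℝ)) x := by
  obtain ⟨α, h⟩ := exists_isSimplePolytopeData hPH hPhull hw0 hindep hspan htangent
  rw [hPhull, ← h.polarSum_eq hpol x]
  exact Finset.sum_congr rfl fun p hp => h.signed_indicator_eq_prod hp (hpol p hp) x
end

section
/- In Lerman's construction, the zero level set of the moment map of the subtorus equals the preimage of the dual image of the cone: φ_K^{-1}(0) = φ^{-1}(β*(C)). In particular, β*(g*) ∩ {ξ ∈ (ℝ^d)* : ⟨ξ, e_i⟩ ≥ 0 for all i = 1, …, d} = β*(C). -/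
open Module

theorem LinearMap.dualMap_subtype_ker_eq_zero_iff {K V W : Type*} [Field K] [AddCommGroup V]
    [Module K V] [AddCommGroup W] [Module K W] (f : V →ₗ[K] W) (ξ : Module.Dual K V) :
    (LinearMap.ker f).subtype.dualMap ξ = 0 ↔ ξ ∈ Set.range f.dualMap := by
  rw [← LinearMap.mem_ker, LinearMap.ker_dualMap_eq_dualAnnihilator_range,
    Submodule.range_subtype, ← LinearMap.range_dualMap_eq_dualAnnihilator_ker,
    ← LinearMap.coe_range, SetLike.mem_coe]

theorem LinearMap.range_dualMap_inter_nonneg {R V W ι : Type*} [CommSemiring R] [LE R]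
    [AddCommMonoid V] [Module R V] [AddCommMonoid W] [Module R W] (f : V →ₗ[R] W) (e : ι → V) :
    Set.range f.dualMap ∩ {ξ : Module.Dual R V | ∀ i, 0 ≤ ξ (e i)} =
      f.dualMap '' {η : Module.Dual R W | ∀ i, 0 ≤ η (f (e i))} := by
  rw [Set.inter_comm, ← Set.image_preimage_eq_inter_range]
  rfl

/-- **Lerman's construction: the zero level set of `φ_K`.**
`β : ℝ^d → g` is the surjective linear map with `β(e_i) = v_i`,
`ι : k = ker β → ℝ^d` the inclusion, `β*` and `ι*` the dual maps,
`C = {η ∈ g* : ⟨η, v_i⟩ ≥ 0 ∀ i}`, and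
`φ(z) = Σ_j |z_j|² e_j^*` the moment map of the standard `𝕋^d`-action on
`ℂ^d` (here `e_j^*` is the `j`-th coordinate functional `LinearMap.proj j`),
with `φ_K = ι* ∘ φ`.  Then `φ_K⁻¹(0) = φ⁻¹(β*(C))`, and in particular
`β*(g*) ∩ {ξ : ⟨ξ, e_i⟩ ≥ 0 ∀ i} = β*(C)`. -/
theorem lerman_zero_level_set
    {g : Type*} [AddCommGroup g] [Module ℝ g] [FiniteDimensional ℝ g]
    {d : ℕ} (v : Fin d → g)
    (β : (Fin d → ℝ) →ₗ[ℝ] g)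
    (hβ : ∀ i, β (Pi.single i 1) = v i)
    (hsurj : Function.Surjective β) :
    {z : Fin d → ℂ |
        (LinearMap.ker β).subtype.dualMap
          (∑ j, Complex.normSq (z j) •
            (LinearMap.proj j : ((Fin d → ℝ) →ₗ[ℝ] ℝ))) = 0} =
      {z : Fin d → ℂ |
        (∑ j, Complex.normSq (z j) •
            (LinearMap.proj j : ((Fin d → ℝ) →ₗ[ℝ] ℝ))) ∈
          β.dualMap '' {η : Module.Dual ℝ g | ∀ i, 0 ≤ η (v i)}} ∧
    Set.range β.dualMap ∩
        {ξ : Module.Dual ℝ (Fin d → ℝ) | ∀ i, 0 ≤ ξ (Pi.single i 1)} =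
      β.dualMap '' {η : Module.Dual ℝ g | ∀ i, 0 ≤ η (v i)} := by
  obtain rfl : (fun i => β (Pi.single i 1)) = v := funext hβ
  have hC := β.range_dualMap_inter_nonneg (fun i : Fin d => Pi.single i (1 : ℝ))
  refine ⟨?_, hC⟩
  ext z
  rw [Set.mem_ofPred_eq, Set.mem_ofPred_eq, ← hC, LinearMap.dualMap_subtype_ker_eq_zero_iff,
    Set.mem_inter_iff, iff_self_and]
  intro _ i
  simp [LinearMap.sum_apply, Pi.single_apply, Complex.normSq_nonneg]
end

section
/- Delzant's weight lemma (diagonal case): If the representation ρ of the torus T^n on ℂ^n determined by the integer weight vectors w_1, …, w_n is faithful (i.e. ρ is injective), then (w_1, …, w_n) is a ℤ-basis of ℤ^n; equivalently, the n × n integer matrix W whose rows are w_1, …, w_n satisfies det W = ±1. -/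
open Complex

open scoped Matrix

/-- If every real vector mapped to an integer vector by the integer matrix `W` is itself integral,
then `W` is nonsingular. -/
theorem Matrix.det_intCast_ne_zero_of_integral_of_mulVec_integral {n : Type*} [Fintype n]
    [DecidableEq n] (W : Matrix n n ℤ)
    (h : ∀ t : n → ℝ, (∀ j, ∃ m : ℤ, (W.map (Int.cast : ℤ → ℝ) *ᵥ t) j = m) →
      ∀ i, ∃ m : ℤ, t i = m) :
    (W.map (Int.cast : ℤ → ℝ)).det ≠ 0 := by
  intro hdet
  obtain ⟨v, hv, hWv⟩ := Matrix.exists_mulVec_eq_zero_iff.mpr hdet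
  obtain ⟨i, hi⟩ := Function.ne_iff.mp hv
  have hi' : v i ≠ 0 := hi
  obtain ⟨m, hm⟩ := h ((2 * v i)⁻¹ • v) (fun j => ⟨0, by simp [Matrix.mulVec_smul, hWv]⟩) i
  have hm' : (1 : ℝ) = 2 * m := by
    rw [← hm, Pi.smul_apply, smul_eq_mul]
    field_simp
  have hm'' : (1 : ℤ) = 2 * m := by exact_mod_cast hm'
  omega

/-- If every real vector mapped to an integer vector by the integer matrix `W` is itself integral,
then `W` is invertible over `ℤ`. -/
theorem Matrix.isUnit_det_of_integral_of_mulVec_integral {n : Type*} [Fintype n]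
    [DecidableEq n] (W : Matrix n n ℤ)
    (h : ∀ t : n → ℝ, (∀ j, ∃ m : ℤ, (W.map (Int.cast : ℤ → ℝ) *ᵥ t) j = m) →
      ∀ i, ∃ m : ℤ, t i = m) :
    IsUnit W.det := by
  set A := W.map (Int.cast : ℤ → ℝ) with hA
  have hinv : A * A⁻¹ = 1 := Matrix.mul_nonsing_inv A
    (isUnit_iff_ne_zero.mpr (W.det_intCast_ne_zero_of_integral_of_mulVec_integral h))
  have hint : ∀ k i, ∃ m : ℤ, A⁻¹ i k = m := by
    intro k
    refine h (fun i => A⁻¹ i k) fun j => ⟨(1 : Matrix n n ℤ) j k, ?_⟩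
    change (A * A⁻¹) j k = _
    rw [hinv]
    simp [Matrix.one_apply]
  choose b hb using hint
  have hWB : W * Matrix.of (fun i k => b k i) = 1 := by
    ext j k
    have hjk := congrFun (congrFun hinv j) k
    simp only [Matrix.mul_apply, hb, Matrix.one_apply] at hjk
    simp only [hA, Matrix.map_apply] at hjk
    simp only [Matrix.mul_apply, Matrix.of_apply, Matrix.one_apply]
    exact_mod_cast hjk
  exact Matrix.isUnit_det_of_right_inverse hWB

/-- **Delzant's weight lemma (diagonal case).**  The representation `ρ` of the
torus `T^n = ℝ^n/ℤ^n` on `ℂ^n` determined by integer weight vectors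
`w 0, …, w (n-1)` sends the class of `t ∈ ℝ^n` to the diagonal unitary
transformation multiplying the `j`-th coordinate by `exp(2πi⟨w_j, t⟩)`.
Faithfulness of `ρ` says precisely that if `ρ[t]` is the identity, i.e.
`exp(2πi⟨w_j, t⟩) = 1` for all `j`, then `t ∈ ℤ^n`.  Under this hypothesis,
`(w_1, …, w_n)` is a `ℤ`-basis of `ℤ^n`; equivalently, the integer matrix `W`
whose rows are the `w_j` satisfies `det W = ±1`. -/
theorem delzant_weight_lemma_diagonal
    {n : ℕ} (w : Fin n → Fin n → ℤ)
    (hfaithful : ∀ t : Fin n → ℝ,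
      (∀ j : Fin n,
        Complex.exp (2 * (Real.pi : ℂ) * Complex.I *
          ((∑ i, (w j i : ℝ) * t i : ℝ) : ℂ)) = 1) →
      ∀ i, ∃ m : ℤ, t i = (m : ℝ)) :
    (Matrix.of w).det = 1 ∨ (Matrix.of w).det = -1 := by
  refine Int.isUnit_iff.mp
    (Matrix.isUnit_det_of_integral_of_mulVec_integral _ fun t ht => hfaithful t fun j => ?_)
  obtain ⟨m, hm⟩ := ht j
  have hsum : ∑ i, (w j i : ℝ) * t i = m := hm
  rw [hsum, Complex.exp_eq_one_iff]
  exact ⟨m, by push_cast; ring⟩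
end
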